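/- arXiv:1809.07065 — 4 statements merged into one kernel-verified Lean document; each statement's English description precedes it below -/
import Mathlib

section
/- Let r ≥ 1 and let η̲ = (η_1 ≥ η_2 ≥ ⋯ ≥ η_r ≥ 0) be a weakly decreasing sequence of nonnegative integers; set η_{r+1} = 0 and n_i = η_i − η_{i+1} for 1 ≤ i ≤ r. Then the number of restricted partition overlaid patterns of rank r with bounding sequence η̲ equals ∏_{i=1}^{r} ( C(2r−1, i) − C(2r−1, i−2) )^{n_i}, where C(n,k) denotes the binomial coefficient (with C(n,k) = 0 for k < 0). -/
namespace SpWeyl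

/-! ### Partitions fitting into rectangles -/

/-- A partition fitting into the rectangle `(a, b)`: a weakly increasing sequence
`s(1) ≤ ⋯ ≤ s(a)` of nonnegative integers, each at most `b`.  It is encoded as a
function `ℕ → ℕ` (with `s p` the `p`-th part, `1 ≤ p ≤ a`) vanishing outside
`{1, …, a}`. -/
def FitsRect (a b : ℕ) (s : ℕ → ℕ) : Prop :=
  (∀ p q, 1 ≤ p → p ≤ q → q ≤ a → s p ≤ s q) ∧
  (∀ p, 1 ≤ p → p ≤ a → s p ≤ b) ∧
  (∀ p, ¬(1 ≤ p ∧ p ≤ a) → s p = 0)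

noncomputable instance fitsRectFintype (a b : ℕ) : Fintype {s : ℕ → ℕ // FitsRect a b s} :=
  Fintype.ofInjective
    (fun s => (fun p : Fin a => (⟨s.1 (p + 1), by
      have h2 := s.2.2.1 (p + 1) (by omega) (by omega)
      omega⟩ : Fin (b + 1))))
    (by
      intro s t hst
      apply Subtype.ext
      funext p
      by_cases hp : 1 ≤ p ∧ p ≤ a
      · have h := congrFun hst ⟨p - 1, by omega⟩
        have h' := congrArg Fin.val h
        simpa [Nat.sub_add_cancel hp.1] using h'
      · rw [s.2.2.2 p hp, t.2.2.2 p hp])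

/-! ### Generalized Gelfand–Tsetlin patterns of type `C` -/

/-- A generalized Gelfand–Tsetlin pattern of type `C` and rank `r`: integer rows
`η¹, λ¹, η², λ², …, η^r, λ^r` with `η^j = (η^j_1, …, η^j_j)`, `λ^j = (λ^j_1, …, λ^j_j)`,
satisfying `λ^j_i ≥ η^j_i ≥ λ^j_{i+1}` for `1 ≤ i ≤ j ≤ r` (with `λ^j_{j+1} = 0`) and
`η^{j+1}_i ≥ λ^j_i ≥ η^{j+1}_{i+1}` for `1 ≤ i ≤ j < r`.  The entry `η^j_i` is `eta j i`,
and all out-of-range entries are normalized to `0`. -/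
structure PatternC (r : ℕ) where
  eta : ℕ → ℕ → ℤ
  lam : ℕ → ℕ → ℤ
  eta_supp : ∀ j i, ¬(1 ≤ i ∧ i ≤ j ∧ j ≤ r) → eta j i = 0
  lam_supp : ∀ j i, ¬(1 ≤ i ∧ i ≤ j ∧ j ≤ r) → lam j i = 0
  ineq1 : ∀ j i, 1 ≤ i → i ≤ j → j ≤ r → lam j i ≥ eta j i ∧ eta j i ≥ lam j (i + 1)
  ineq2 : ∀ j i, 1 ≤ i → i ≤ j → j < r → eta (j + 1) i ≥ lam j i ∧ lam j i ≥ eta (j + 1) (i + 1)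

/-- The difference `ℓ_{i,j̄} = λ^j_i - η^j_i`. -/
def PatternC.lbar {r : ℕ} (P : PatternC r) (i j : ℕ) : ℕ := (P.lam j i - P.eta j i).toNat

/-- The difference `ℓ′_{i,j̄} = η^j_i - λ^j_{i+1}`. -/
def PatternC.lbar' {r : ℕ} (P : PatternC r) (i j : ℕ) : ℕ := (P.eta j i - P.lam j (i + 1)).toNat

/-- The difference `ℓ_{i,j} = η^{j+1}_i - λ^j_i`. -/
def PatternC.lreg {r : ℕ} (P : PatternC r) (i j : ℕ) : ℕ := (P.eta (j + 1) i - P.lam j i).toNat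

/-- The difference `ℓ′_{i,j} = λ^j_i - η^{j+1}_{i+1}`. -/
def PatternC.lreg' {r : ℕ} (P : PatternC r) (i j : ℕ) : ℕ :=
  (P.lam j i - P.eta (j + 1) (i + 1)).toNat

/-- The bounding sequence of a pattern is its last row `λ^r`. -/
def PatternC.Bounds {r : ℕ} (P : PatternC r) (lamb : ℕ → ℕ) : Prop :=
  ∀ i, 1 ≤ i → i ≤ r → P.lam r i = (lamb i : ℤ)

/-- The coefficient `a_j = 2 Σ_{i≤j} η^j_i - Σ_{i≤j} λ^j_i - Σ_{i≤j-1} λ^{j-1}_i`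
of `ε_j` in the weight of a pattern. -/
def PatternC.aCoeff {r : ℕ} (P : PatternC r) (j : ℕ) : ℤ :=
  2 * (∑ i ∈ Finset.Icc 1 j, P.eta j i) - (∑ i ∈ Finset.Icc 1 j, P.lam j i)
    - (∑ i ∈ Finset.Icc 1 (j - 1), P.lam (j - 1) i)

/-- A partition overlaid pattern (POP) of type `C` and rank `r`: a pattern together with
partitions `s_{i,j̄}` fitting into `(ℓ_{i,j̄}, ℓ′_{i,j̄})` for `1 ≤ i ≤ j ≤ r` and
`s_{i,j}` fitting into `(ℓ_{i,j}, ℓ′_{i,j})` for `1 ≤ i ≤ j < r`. -/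
structure POPC (r : ℕ) extends PatternC r where
  sbar : ℕ → ℕ → ℕ → ℕ
  sreg : ℕ → ℕ → ℕ → ℕ
  sbar_fits : ∀ i j, 1 ≤ i → i ≤ j → j ≤ r →
    FitsRect (toPatternC.lbar i j) (toPatternC.lbar' i j) (sbar i j)
  sreg_fits : ∀ i j, 1 ≤ i → i ≤ j → j < r →
    FitsRect (toPatternC.lreg i j) (toPatternC.lreg' i j) (sreg i j)
  sbar_supp : ∀ i j, ¬(1 ≤ i ∧ i ≤ j ∧ j ≤ r) → sbar i j = fun _ => 0
  sreg_supp : ∀ i j, ¬(1 ≤ i ∧ i ≤ j ∧ j < r) → sreg i j = fun _ => 0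

/-! ### Restricted patterns -/

/-- A restricted pattern of rank `r`: rows `η¹, λ¹, …, λ^{r-1}, η^r`, satisfying
`λ^j_i ≥ η^j_i ≥ λ^j_{i+1}` and `η^{j+1}_i ≥ λ^j_i ≥ η^{j+1}_{i+1}` for `1 ≤ i ≤ j < r`. -/
structure RPattern (r : ℕ) where
  eta : ℕ → ℕ → ℤ
  lam : ℕ → ℕ → ℤ
  eta_supp : ∀ j i, ¬(1 ≤ i ∧ i ≤ j ∧ j ≤ r) → eta j i = 0
  lam_supp : ∀ j i, ¬(1 ≤ i ∧ i ≤ j ∧ j < r) → lam j i = 0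
  ineq1 : ∀ j i, 1 ≤ i → i ≤ j → j < r → lam j i ≥ eta j i ∧ eta j i ≥ lam j (i + 1)
  ineq2 : ∀ j i, 1 ≤ i → i ≤ j → j < r → eta (j + 1) i ≥ lam j i ∧ lam j i ≥ eta (j + 1) (i + 1)

def RPattern.lbar {r : ℕ} (P : RPattern r) (i j : ℕ) : ℕ := (P.lam j i - P.eta j i).toNat

def RPattern.lbar' {r : ℕ} (P : RPattern r) (i j : ℕ) : ℕ := (P.eta j i - P.lam j (i + 1)).toNat

def RPattern.lreg {r : ℕ} (P : RPattern r) (i j : ℕ) : ℕ := (P.eta (j + 1) i - P.lam j i).toNat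

def RPattern.lreg' {r : ℕ} (P : RPattern r) (i j : ℕ) : ℕ :=
  (P.lam j i - P.eta (j + 1) (i + 1)).toNat

/-- The bounding sequence of a restricted pattern is its last row `η^r`. -/
def RPattern.Bounds {r : ℕ} (P : RPattern r) (etab : ℕ → ℕ) : Prop :=
  ∀ i, 1 ≤ i → i ≤ r → P.eta r i = (etab i : ℤ)

/-- A restricted partition overlaid pattern of rank `r`: a restricted pattern together with
partitions `s_{i,j̄}` fitting into `(ℓ_{i,j̄}, ℓ′_{i,j̄})` and `s_{i,j}` fitting into
`(ℓ_{i,j}, ℓ′_{i,j})` for `1 ≤ i ≤ j < r`. -/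
structure RPOP (r : ℕ) extends RPattern r where
  sbar : ℕ → ℕ → ℕ → ℕ
  sreg : ℕ → ℕ → ℕ → ℕ
  sbar_fits : ∀ i j, 1 ≤ i → i ≤ j → j < r →
    FitsRect (toRPattern.lbar i j) (toRPattern.lbar' i j) (sbar i j)
  sreg_fits : ∀ i j, 1 ≤ i → i ≤ j → j < r →
    FitsRect (toRPattern.lreg i j) (toRPattern.lreg' i j) (sreg i j)
  sbar_supp : ∀ i j, ¬(1 ≤ i ∧ i ≤ j ∧ j < r) → sbar i j = fun _ => 0
  sreg_supp : ∀ i j, ¬(1 ≤ i ∧ i ≤ j ∧ j < r) → sreg i j = fun _ => 0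

/-! ### Counting partitions in a rectangle -/

theorem fitsRect_card (a b : ℕ) :
    Nat.card {s : ℕ → ℕ // FitsRect a b s} = (a + b).choose a := by
  induction a generalizing b with
  | zero =>
    have : Unique {s : ℕ → ℕ // FitsRect 0 b s} :=
      { default := ⟨fun _ => 0, by
          refine ⟨?_, ?_, ?_⟩ <;> intros <;> simp⟩
        uniq := by
          rintro ⟨s, hs⟩
          apply Subtype.ext
          funext p
          exact hs.2.2 p (by omega) }
    simp
  | succ a iha =>
    induction b with
    | zero =>
      have : Unique {s : ℕ → ℕ // FitsRect (a + 1) 0 s} :=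
        { default := ⟨fun _ => 0, by
            refine ⟨?_, ?_, ?_⟩ <;> intros <;> simp⟩
          uniq := by
            rintro ⟨s, hs⟩
            apply Subtype.ext
            funext p
            show s p = 0
            by_cases hp : 1 ≤ p ∧ p ≤ a + 1
            · exact Nat.le_zero.1 (hs.2.1 p hp.1 hp.2)
            · exact hs.2.2 p hp }
      simp
    | succ b ihb =>
      let f : {s : ℕ → ℕ // FitsRect a (b + 1) s} ⊕ {s : ℕ → ℕ // FitsRect (a + 1) b s} →
          {s : ℕ → ℕ // FitsRect (a + 1) (b + 1) s} := fun t => match t with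
        | Sum.inl s => ⟨fun p => if p = a + 1 then b + 1 else s.1 p, by
            obtain ⟨s, h1, h2, h3⟩ := s
            refine ⟨?_, ?_, ?_⟩
            · intro p q hp hpq hq
              dsimp only
              split_ifs with h h' h'
              · exact le_rfl
              · omega
              · exact h2 p hp (by omega)
              · exact h1 p q hp hpq (by omega)
            · intro p hp hq
              dsimp only
              split_ifs with h
              · exact le_rfl
              · exact h2 p hp (by omega)
            · intro p hp
              dsimp only
              rw [if_neg (by omega)]
              exact h3 p (by omega)⟩
        | Sum.inr s => ⟨s.1, by
            obtain ⟨s, h1, h2, h3⟩ := s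
            exact ⟨h1, fun p hp hq => (h2 p hp hq).trans (by omega), h3⟩⟩
      have hf : Function.Bijective f := by
        constructor
        · rintro (⟨s, hs⟩ | ⟨s, hs⟩) (⟨t, ht⟩ | ⟨t, ht⟩) h
          · have h := congrArg Subtype.val h
            congr 2
            funext p
            have hp := congrFun h p
            by_cases hpa : p = a + 1
            · rw [hs.2.2 p (by omega), ht.2.2 p (by omega)]
            · simpa [f, hpa] using hp
          · have h := congrFun (congrArg Subtype.val h) (a + 1)
            have h2 := ht.2.1 (a + 1) (by omega) le_rfl
            simp [f] at h
            omega
          · have h := congrFun (congrArg Subtype.val h) (a + 1)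
            have h2 := hs.2.1 (a + 1) (by omega) le_rfl
            simp [f] at h
            omega
          · have h := congrArg Subtype.val h
            congr 2
        · rintro ⟨s, h1, h2, h3⟩
          by_cases hb : s (a + 1) = b + 1
          · refine ⟨Sum.inl ⟨fun p => if p = a + 1 then 0 else s p, ?_, ?_, ?_⟩, ?_⟩
            · intro p q hp hpq hq
              dsimp only
              rw [if_neg (by omega), if_neg (by omega)]
              exact h1 p q hp hpq (by omega)
            · intro p hp hq
              dsimp only
              rw [if_neg (by omega)]
              exact h2 p hp (by omega)
            · intro p hp
              dsimp only
              split_ifs with h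
              · rfl
              · exact h3 p (by omega)
            · apply Subtype.ext
              funext p
              by_cases hpa : p = a + 1
              · subst hpa; simp [f, hb]
              · simp [f, hpa]
          · refine ⟨Sum.inr ⟨s, h1, ?_, h3⟩, rfl⟩
            intro p hp hq
            have e1 := h1 p (a + 1) hp hq le_rfl
            have e2 := h2 (a + 1) (by omega) le_rfl
            omega
      rw [← Nat.card_congr (Equiv.ofBijective f hf), Nat.card_sum, iha, ihb]
      have e1 : a + 1 + (b + 1) = (a + b + 1) + 1 := by ring
      have e2 : a + (b + 1) = a + b + 1 := by ring
      have e3 : a + 1 + b = a + b + 1 := by ring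
      rw [e1, e2, e3, Nat.choose_succ_succ (a + b + 1) a]

/-! ### One step of a pattern -/

/-- One entry together with its overlaid partition. -/
abbrev Cell (n : ℕ) : Type := Σ k : Fin (n + 1), {s : ℕ → ℕ // FitsRect (n - k) k s}

theorem Cell.ext' {n : ℕ} {t t' : Cell n} (h1 : t.1.1 = t'.1.1) (h2 : t.2.1 = t'.2.1) : t = t' := by
  obtain ⟨⟨k, hk⟩, ⟨s, hs⟩⟩ := t
  obtain ⟨⟨k', hk'⟩, ⟨s', hs'⟩⟩ := t'
  dsimp only at h1 h2
  subst h1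
  subst h2
  rfl

/-- One row of `m` entries interlacing with `a`, together with the overlaid partitions. -/
abbrev Step (m : ℕ) (a : ℕ → ℕ) : Type := (i : Fin m) → Cell (a (i + 1) - a (i + 1 + 1))

/-- The entries of the row. -/
def row {m : ℕ} {a : ℕ → ℕ} (p : Step m a) (i : ℕ) : ℕ :=
  if h : 1 ≤ i ∧ i ≤ m then a (i + 1) + ((p ⟨i - 1, by omega⟩).1 : ℕ) else 0

/-- The partitions of the row. -/
def prt {m : ℕ} {a : ℕ → ℕ} (p : Step m a) (i : ℕ) : ℕ → ℕ :=
  if h : 1 ≤ i ∧ i ≤ m then (p ⟨i - 1, by omega⟩).2.1 else fun _ => 0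

theorem row_out {m : ℕ} {a : ℕ → ℕ} (p : Step m a) (i : ℕ) (h : ¬(1 ≤ i ∧ i ≤ m)) :
    row p i = 0 := by simp only [row, dif_neg h]

theorem prt_out {m : ℕ} {a : ℕ → ℕ} (p : Step m a) (i : ℕ) (h : ¬(1 ≤ i ∧ i ≤ m)) :
    prt p i = fun _ => 0 := by simp only [prt, dif_neg h]

theorem row_fin {m : ℕ} {a : ℕ → ℕ} (p : Step m a) (i : Fin m) :
    row p (i + 1) = a (i + 1 + 1) + ((p i).1 : ℕ) := by
  simp only [row, dif_pos (show 1 ≤ (i : ℕ) + 1 ∧ (i : ℕ) + 1 ≤ m by omega)]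
  rfl

theorem prt_fin {m : ℕ} {a : ℕ → ℕ} (p : Step m a) (i : Fin m) :
    prt p (i + 1) = (p i).2.1 := by
  simp only [prt, dif_pos (show 1 ≤ (i : ℕ) + 1 ∧ (i : ℕ) + 1 ≤ m by omega)]
  rfl

theorem row_spec {m : ℕ} {a : ℕ → ℕ} (p : Step m a) (i : ℕ) (h1 : 1 ≤ i) (h2 : i ≤ m)
    (ha : a (i + 1) ≤ a i) :
    a (i + 1) ≤ row p i ∧ row p i ≤ a i ∧
      FitsRect (a i - row p i) (row p i - a (i + 1)) (prt p i) := by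
  obtain ⟨k, rfl⟩ : ∃ k : Fin m, i = k + 1 := ⟨⟨i - 1, by omega⟩, by simp; omega⟩
  rw [row_fin, prt_fin]
  have hk := (p k).1.2
  refine ⟨by omega, by omega, ?_⟩
  have hs := (p k).2.2
  convert hs using 1 <;> omega

theorem step_ext {m : ℕ} {a : ℕ → ℕ} {p q : Step m a} (h1 : row p = row q)
    (h2 : prt p = prt q) : p = q := by
  funext i
  apply Cell.ext'
  · have := congrFun h1 (i + 1)
    rw [row_fin, row_fin] at this
    omega
  · have := congrFun h2 (i + 1)
    rwa [prt_fin, prt_fin] at this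

theorem step_exists {m : ℕ} {a : ℕ → ℕ} (mu : ℕ → ℕ) (sg : ℕ → ℕ → ℕ)
    (h : ∀ i, 1 ≤ i → i ≤ m → a (i + 1) ≤ mu i ∧ mu i ≤ a i ∧
      FitsRect (a i - mu i) (mu i - a (i + 1)) (sg i))
    (h0 : ∀ i, ¬(1 ≤ i ∧ i ≤ m) → mu i = 0)
    (h0' : ∀ i, ¬(1 ≤ i ∧ i ≤ m) → sg i = fun _ => 0) :
    ∃ p : Step m a, row p = mu ∧ prt p = sg := by
  let p : Step m a := fun i =>
    ⟨⟨mu (i + 1) - a (i + 1 + 1), by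
        have := h (i + 1) (by omega) (by omega)
        omega⟩, ⟨sg (i + 1), by
        obtain ⟨e1, e2, e3⟩ := h (i + 1) (by omega) (by omega)
        convert e3 using 1
        show _ - (mu (i + 1) - a (i + 1 + 1)) = _
        omega⟩⟩
  refine ⟨p, ?_, ?_⟩
  · funext i
    by_cases hi : 1 ≤ i ∧ i ≤ m
    · obtain ⟨k, rfl⟩ : ∃ k : Fin m, i = k + 1 := ⟨⟨i - 1, by omega⟩, by simp; omega⟩
      rw [row_fin]
      have := (h (k + 1) hi.1 hi.2).1
      show _ + (mu (k + 1) - a (k + 1 + 1)) = _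
      omega
    · rw [row_out p i hi, h0 i hi]
  · funext i
    by_cases hi : 1 ≤ i ∧ i ≤ m
    · obtain ⟨k, rfl⟩ : ∃ k : Fin m, i = k + 1 := ⟨⟨i - 1, by omega⟩, by simp; omega⟩
      rw [prt_fin]
    · rw [prt_out p i hi, h0' i hi]

theorem prod_Icc_fin (m : ℕ) (f : ℕ → ℚ) :
    ∏ i ∈ Finset.Icc 1 m, f i = ∏ i : Fin m, f (i + 1) := by
  induction m with
  | zero => simp
  | succ m ih => rw [Finset.prod_Icc_succ_top (by omega), ih, Fin.prod_univ_castSucc]; simp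

theorem cell_sum (n b : ℕ) (x : ℚ) :
    ∑ t : Cell n, x ^ (b + (t.1 : ℕ)) = x ^ b * (1 + x) ^ n := by
  rw [Fintype.sum_sigma]
  simp only [Finset.sum_const, Finset.card_univ, nsmul_eq_mul]
  have : ∀ k : Fin (n + 1), Fintype.card {s : ℕ → ℕ // FitsRect (n - k) k s} = n.choose k := by
    intro k
    rw [← Nat.card_eq_fintype_card, fitsRect_card]
    have hk : (k : ℕ) ≤ n := by omega
    rw [Nat.sub_add_cancel hk, Nat.choose_symm hk]
  simp only [this]
  rw [add_comm 1 x, add_pow, Finset.mul_sum,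
    Fin.sum_univ_eq_sum_range (fun k => (n.choose k : ℚ) * x ^ (b + k))]
  apply Finset.sum_congr rfl
  intro k _
  rw [pow_add]
  ring

theorem step_sum (m : ℕ) (a : ℕ → ℕ) (x : ℕ → ℚ) :
    ∑ p : Step m a, ∏ i ∈ Finset.Icc 1 m, x i ^ row p i =
      ∏ i ∈ Finset.Icc 1 m, (x i ^ a (i + 1) * (1 + x i) ^ (a i - a (i + 1))) := by
  simp only [prod_Icc_fin, row_fin]
  simp only [← cell_sum]
  rw [Finset.prod_univ_sum, Fintype.piFinset_univ]

theorem tele1 (m : ℕ) (a : ℕ → ℕ) (c : ℕ → ℚ) (c0 : c 0 = 1) (hc : ∀ i, i ≤ m → c i ≠ 0)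
    (ha : ∀ i, 1 ≤ i → i ≤ m → a (i + 1) ≤ a i) :
    ∏ i ∈ Finset.Icc 1 m, (c i / c (i - 1)) ^ a i =
      c m ^ a (m + 1) * ∏ i ∈ Finset.Icc 1 m, c i ^ (a i - a (i + 1)) := by
  induction m with
  | zero => simp [c0]
  | succ m ih =>
    rw [Finset.prod_Icc_succ_top (by omega), Finset.prod_Icc_succ_top (by omega),
      ih (fun i hi => hc i (by omega)) (fun i h1 h2 => ha i h1 (by omega))]
    obtain ⟨n, hn⟩ := Nat.exists_eq_add_of_le (ha (m + 1) (by omega) le_rfl)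
    have h1 := hc m (by omega)
    rw [hn, Nat.add_sub_cancel_left, Nat.add_sub_cancel, div_pow, pow_add (c (m + 1))]
    field_simp

theorem tele2 (m : ℕ) (a : ℕ → ℕ) (c : ℕ → ℚ) (c0 : c 0 = 1) (hc : ∀ i, i ≤ m → c i ≠ 0)
    (ha : ∀ i, 1 ≤ i → i ≤ m → a (i + 1) ≤ a i) :
    ∏ i ∈ Finset.Icc 1 m,
        ((c i / c (i - 1)) ^ a (i + 1) * (1 + c i / c (i - 1)) ^ (a i - a (i + 1))) =
      c m ^ a (m + 1) * ∏ i ∈ Finset.Icc 1 m, (c i + c (i - 1)) ^ (a i - a (i + 1)) := by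
  induction m with
  | zero => simp [c0]
  | succ m ih =>
    rw [Finset.prod_Icc_succ_top (by omega), Finset.prod_Icc_succ_top (by omega),
      ih (fun i hi => hc i (by omega)) (fun i h1 h2 => ha i h1 (by omega))]
    obtain ⟨n, hn⟩ := Nat.exists_eq_add_of_le (ha (m + 1) (by omega) le_rfl)
    have h1 := hc m (by omega)
    have h2 : 1 + c (m + 1) / c m = (c (m + 1) + c m) / c m := by field_simp; ring
    rw [hn, Nat.add_sub_cancel_left, Nat.add_sub_cancel, h2, div_pow, div_pow, pow_add (c m)]
    field_simp

theorem row_dec {m : ℕ} {a : ℕ → ℕ} (ha : ∀ i, 1 ≤ i → i ≤ m → a (i + 1) ≤ a i) (p : Step m a) :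
    ∀ i, 1 ≤ i → i ≤ m → row p (i + 1) ≤ row p i := by
  intro i h1 h2
  have e := (row_spec p i h1 h2 (ha i h1 h2)).1
  by_cases h3 : i + 1 ≤ m
  · exact (row_spec p (i + 1) (by omega) h3 (ha _ (by omega) h3)).2.1.trans e
  · rw [row_out p (i + 1) (by omega)]
    omega

theorem step_sum' (m : ℕ) (a : ℕ → ℕ) (c : ℕ → ℚ) (c0 : c 0 = 1) (hc : ∀ i, i ≤ m → c i ≠ 0)
    (ha : ∀ i, 1 ≤ i → i ≤ m → a (i + 1) ≤ a i) :
    ∑ p : Step m a, ∏ i ∈ Finset.Icc 1 m, c i ^ (row p i - row p (i + 1)) =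
      c m ^ a (m + 1) * ∏ i ∈ Finset.Icc 1 m, (c i + c (i - 1)) ^ (a i - a (i + 1)) := by
  rw [← tele2 m a c c0 hc ha, ← step_sum m a (fun i => c i / c (i - 1))]
  apply Finset.sum_congr rfl
  intro p _
  rw [tele1 m (row p) c c0 hc (row_dec ha p), row_out p (m + 1) (by omega)]
  simp

/-! ### The recursion for restricted overlaid patterns -/

theorem RPOP.ext' {r : ℕ} {Q Q' : RPOP r} (h1 : Q.eta = Q'.eta) (h2 : Q.lam = Q'.lam)
    (h3 : Q.sbar = Q'.sbar) (h4 : Q.sreg = Q'.sreg) : Q = Q' := by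
  obtain ⟨⟨e, l, _, _, _, _⟩, sb, sr, _, _, _, _⟩ := Q
  obtain ⟨⟨e', l', _, _, _, _⟩, sb', sr', _, _, _, _⟩ := Q'
  dsimp only at h1 h2 h3 h4
  subst h1 h2 h3 h4
  rfl

/-- Restricted overlaid patterns with a given bounding sequence. -/
abbrev BP (r : ℕ) (a : ℕ → ℕ) : Type := {Q : RPOP r // Q.toRPattern.Bounds a}

/-- Add two rows to a restricted pattern. -/
def gluePat {r : ℕ} {a : ℕ → ℕ} (ha : ∀ i, 1 ≤ i → i ≤ r → a (i + 1) ≤ a i)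
    (p : Step r a) (q : Step r (row p)) (Q : BP r (row q)) : RPattern (r + 1) where
  eta j i := if j ≤ r then Q.1.eta j i else if j = r + 1 ∧ 1 ≤ i ∧ i ≤ r + 1 then (a i : ℤ) else 0
  lam j i := if j < r then Q.1.lam j i else if j = r then (row p i : ℤ) else 0
  eta_supp := by
    intro j i h
    split_ifs with h1 h2
    · exact Q.1.eta_supp j i (by omega)
    · omega
    · rfl
  lam_supp := by
    intro j i h
    split_ifs with h1 h2
    · exact Q.1.lam_supp j i (by omega)
    · rw [row_out p i (by omega)]; rfl
    · rfl
  ineq1 := by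
    intro j i h1 h2 h3
    by_cases hj : j < r
    · simp only [hj, hj.le, if_true]
      exact Q.1.ineq1 j i h1 h2 hj
    · obtain rfl : j = r := by omega
      have hs := row_spec q i h1 h2 (row_dec ha p i h1 h2)
      have hb := Q.2 i h1 h2
      simp only [le_refl, lt_irrefl, if_true, if_false, hb]
      omega
  ineq2 := by
    intro j i h1 h2 h3
    by_cases hj : j < r
    · simp only [hj, show j + 1 ≤ r by omega, if_true]
      exact Q.1.ineq2 j i h1 h2 hj
    · obtain rfl : j = r := by omega
      have hs := row_spec p i h1 h2 (ha i h1 h2)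
      simp only [lt_irrefl, if_true, if_false, show ¬ (j + 1 ≤ j) by omega,
        show 1 ≤ i ∧ i ≤ j + 1 by omega, show 1 ≤ i + 1 ∧ i + 1 ≤ j + 1 by omega, and_self]
      omega

/-- Add two rows to a restricted overlaid pattern. -/
def glue {r : ℕ} {a : ℕ → ℕ} (ha : ∀ i, 1 ≤ i → i ≤ r → a (i + 1) ≤ a i)
    (p : Step r a) (q : Step r (row p)) (Q : BP r (row q)) : RPOP (r + 1) where
  toRPattern := gluePat ha p q Q
  sbar i j := if j < r then Q.1.sbar i j else if j = r then prt q i else fun _ => 0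
  sreg i j := if j < r then Q.1.sreg i j else if j = r then prt p i else fun _ => 0
  sbar_fits := by
    intro i j h1 h2 h3
    by_cases hj : j < r
    · have := Q.1.sbar_fits i j h1 h2 hj
      simpa only [RPattern.lbar, RPattern.lbar', gluePat, hj, hj.le, if_true] using this
    · obtain rfl : j = r := by omega
      have hs := row_spec q i h1 h2 (row_dec ha p i h1 h2)
      have hb := Q.2 i h1 h2
      simp only [RPattern.lbar, RPattern.lbar', gluePat, le_refl, lt_irrefl, if_true, if_false, hb]
      convert hs.2.2 using 1 <;> omega
  sreg_fits := by
    intro i j h1 h2 h3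
    by_cases hj : j < r
    · have := Q.1.sreg_fits i j h1 h2 hj
      simpa only [RPattern.lreg, RPattern.lreg', gluePat, hj, show j + 1 ≤ r by omega,
        if_true] using this
    · obtain rfl : j = r := by omega
      have hs := row_spec p i h1 h2 (ha i h1 h2)
      simp only [RPattern.lreg, RPattern.lreg', gluePat, lt_irrefl, if_true, if_false,
        show ¬ (j + 1 ≤ j) by omega,
        show 1 ≤ i ∧ i ≤ j + 1 by omega, show 1 ≤ i + 1 ∧ i + 1 ≤ j + 1 by omega, and_self]
      convert hs.2.2 using 1 <;> omega
  sbar_supp := by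
    intro i j h
    split_ifs with h1 h2
    · exact Q.1.sbar_supp i j (by omega)
    · exact prt_out q i (by omega)
    · rfl
  sreg_supp := by
    intro i j h
    split_ifs with h1 h2
    · exact Q.1.sreg_supp i j (by omega)
    · exact prt_out p i (by omega)
    · rfl

theorem glue_bounds {r : ℕ} {a : ℕ → ℕ} (ha : ∀ i, 1 ≤ i → i ≤ r → a (i + 1) ≤ a i)
    (p : Step r a) (q : Step r (row p)) (Q : BP r (row q)) :
    (glue ha p q Q).toRPattern.Bounds a := by
  intro i h1 h2
  simp only [glue, gluePat, show ¬ (r + 1 ≤ r) by omega, if_false, h1, h2, and_self, if_true]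

/-- The gluing map. -/
def glueMap {r : ℕ} {a : ℕ → ℕ} (ha : ∀ i, 1 ≤ i → i ≤ r → a (i + 1) ≤ a i) :
    (Σ p : Step r a, Σ q : Step r (row p), BP r (row q)) → BP (r + 1) a :=
  fun t => ⟨glue ha t.1 t.2.1 t.2.2, glue_bounds ha t.1 t.2.1 t.2.2⟩

theorem glueMap_injective {r : ℕ} {a : ℕ → ℕ} (ha : ∀ i, 1 ≤ i → i ≤ r → a (i + 1) ≤ a i) :
    Function.Injective (glueMap ha) := by
  rintro ⟨p, q, Q⟩ ⟨p', q', Q'⟩ h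
  have h := congrArg Subtype.val h
  simp only [glueMap] at h
  have he : (glue ha p q Q).eta = (glue ha p' q' Q').eta := by rw [h]
  have hl : (glue ha p q Q).lam = (glue ha p' q' Q').lam := by rw [h]
  have hb : (glue ha p q Q).sbar = (glue ha p' q' Q').sbar := by rw [h]
  have hg : (glue ha p q Q).sreg = (glue ha p' q' Q').sreg := by rw [h]
  clear h
  obtain rfl : p = p' := by
    apply step_ext
    · funext i
      have := congrFun (congrFun hl r) i
      simpa [glue, gluePat] using this
    · funext i
      have := congrFun (congrFun hg i) r
      simpa [glue, gluePat] using this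
  obtain rfl : q = q' := by
    apply step_ext
    · funext i
      by_cases hi : 1 ≤ i ∧ i ≤ r
      · have := congrFun (congrFun he r) i
        have h1 := Q.2 i hi.1 hi.2
        have h2 := Q'.2 i hi.1 hi.2
        simp only [glue, gluePat, le_refl, if_true, h1, h2] at this
        exact_mod_cast this
      · rw [row_out q i hi, row_out q' i hi]
    · funext i
      have := congrFun (congrFun hb i) r
      simpa [glue, gluePat] using this
  obtain rfl : Q = Q' := by
    apply Subtype.ext
    apply RPOP.ext'
    · funext j i
      by_cases hj : j ≤ r
      · have := congrFun (congrFun he j) i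
        simpa only [glue, gluePat, hj, if_true] using this
      · rw [Q.1.eta_supp j i (by omega), Q'.1.eta_supp j i (by omega)]
    · funext j i
      by_cases hj : j < r
      · have := congrFun (congrFun hl j) i
        simpa only [glue, gluePat, hj, if_true] using this
      · rw [Q.1.lam_supp j i (by omega), Q'.1.lam_supp j i (by omega)]
    · funext i j
      by_cases hj : j < r
      · have := congrFun (congrFun hb i) j
        simpa only [glue, gluePat, hj, if_true] using this
      · rw [Q.1.sbar_supp i j (by omega), Q'.1.sbar_supp i j (by omega)]
    · funext i j
      by_cases hj : j < r
      · have := congrFun (congrFun hg i) j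
        simpa only [glue, gluePat, hj, if_true] using this
      · rw [Q.1.sreg_supp i j (by omega), Q'.1.sreg_supp i j (by omega)]
  rfl

/-- Remove the last two rows. -/
def cutPat {r : ℕ} (Q : RPattern (r + 1)) : RPattern r where
  eta j i := if j ≤ r then Q.eta j i else 0
  lam j i := if j < r then Q.lam j i else 0
  eta_supp := by
    intro j i h
    split_ifs with h1
    · exact Q.eta_supp j i (by omega)
    · rfl
  lam_supp := by
    intro j i h
    split_ifs with h1
    · exact Q.lam_supp j i (by omega)
    · rfl
  ineq1 := by
    intro j i h1 h2 h3
    simp only [h3, h3.le, if_true]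
    exact Q.ineq1 j i h1 h2 (by omega)
  ineq2 := by
    intro j i h1 h2 h3
    simp only [h3, show j + 1 ≤ r by omega, if_true]
    exact Q.ineq2 j i h1 h2 (by omega)

/-- Remove the last two rows. -/
def cut {r : ℕ} (Q : RPOP (r + 1)) : RPOP r where
  toRPattern := cutPat Q.toRPattern
  sbar i j := if j < r then Q.sbar i j else fun _ => 0
  sreg i j := if j < r then Q.sreg i j else fun _ => 0
  sbar_fits := by
    intro i j h1 h2 hj
    have := Q.sbar_fits i j h1 h2 (by omega)
    simpa only [RPattern.lbar, RPattern.lbar', cutPat, hj, hj.le, if_true] using this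
  sreg_fits := by
    intro i j h1 h2 hj
    have := Q.sreg_fits i j h1 h2 (by omega)
    simpa only [RPattern.lreg, RPattern.lreg', cutPat, hj, show j + 1 ≤ r by omega,
        if_true] using this
  sbar_supp := by
    intro i j h
    split_ifs with h1
    · exact Q.sbar_supp i j (by omega)
    · rfl
  sreg_supp := by
    intro i j h
    split_ifs with h1
    · exact Q.sreg_supp i j (by omega)
    · rfl

theorem glueMap_surjective {r : ℕ} {a : ℕ → ℕ} (ha : ∀ i, 1 ≤ i → i ≤ r → a (i + 1) ≤ a i) :
    Function.Surjective (glueMap ha) := by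
  rintro ⟨Q, hQ⟩
  have hl0 : ∀ i, 0 ≤ Q.lam r i := by
    intro i
    by_cases hi : 1 ≤ i ∧ i ≤ r
    · have h := (Q.ineq2 r i hi.1 hi.2 (by omega)).2
      rw [hQ (i + 1) (by omega) (by omega)] at h
      omega
    · rw [Q.lam_supp r i (by omega)]
  have he0 : ∀ i, 0 ≤ Q.eta r i := by
    intro i
    by_cases hi : 1 ≤ i ∧ i ≤ r
    · have h := (Q.ineq1 r i hi.1 hi.2 (by omega)).2
      have := hl0 (i + 1)
      omega
    · rw [Q.eta_supp r i (by omega)]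
  obtain ⟨p, hp1, hp2⟩ := step_exists (m := r) (a := a) (fun i => (Q.lam r i).toNat)
    (fun i => Q.sreg i r)
    (by
      intro i h1 h2
      have e := Q.ineq2 r i h1 h2 (by omega)
      have f := Q.sreg_fits i r h1 h2 (by omega)
      simp only [RPattern.lreg, RPattern.lreg'] at f
      have g := hl0 i
      rw [hQ i (by omega) (by omega), hQ (i + 1) (by omega) (by omega)] at e f
      refine ⟨by omega, by omega, ?_⟩
      convert f using 1 <;> omega)
    (by
      intro i hi
      simp only [Q.lam_supp r i (by omega)]; rfl)
    (by
      intro i hi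
      exact Q.sreg_supp i r (by omega))
  obtain ⟨q, hq1, hq2⟩ := step_exists (m := r) (a := row p) (fun i => (Q.eta r i).toNat)
    (fun i => Q.sbar i r)
    (by
      intro i h1 h2
      have e := Q.ineq1 r i h1 h2 (by omega)
      have f := Q.sbar_fits i r h1 h2 (by omega)
      simp only [RPattern.lbar, RPattern.lbar'] at f
      have g := hl0 i
      have g1 := hl0 (i + 1)
      have g2 := he0 i
      simp only [hp1]
      refine ⟨by omega, by omega, ?_⟩
      convert f using 1 <;> omega)
    (by
      intro i hi
      simp only [Q.eta_supp r i (by omega)]; rfl)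
    (by
      intro i hi
      exact Q.sbar_supp i r (by omega))
  refine ⟨⟨p, q, ⟨cut Q, ?_⟩⟩, ?_⟩
  · intro i h1 h2
    have := he0 i
    simp only [cut, cutPat, le_refl, if_true, hq1]
    omega
  · apply Subtype.ext
    apply RPOP.ext'
    · funext j i
      simp only [glueMap, glue, gluePat, cut, cutPat]
      split_ifs with h1 h2
      · rfl
      · obtain ⟨rfl, h3, h4⟩ := h2
        exact (hQ i h3 h4).symm
      · rw [Q.eta_supp j i (by omega)]
    · funext j i
      simp only [glueMap, glue, gluePat, cut, cutPat]
      split_ifs with h1 h2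
      · rfl
      · subst h2
        have := hl0 i
        simp only [hp1]
        omega
      · rw [Q.lam_supp j i (by omega)]
    · funext i j
      simp only [glueMap, glue, cut]
      split_ifs with h1 h2
      · rfl
      · subst h2
        simp only [hq2]
      · rw [Q.sbar_supp i j (by omega)]
    · funext i j
      simp only [glueMap, glue, cut]
      split_ifs with h1 h2
      · rfl
      · subst h2
        simp only [hp2]
      · rw [Q.sreg_supp i j (by omega)]

/-! ### The constants -/

/-- The constants attached to the `η`-rows. -/
def cc : ℕ → ℕ → ℚ
  | 0, i => if i = 0 then 1 else 0
  | r + 1, i =>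
    let d : ℕ → ℚ := fun i => if i = 0 then 1 else if i ≤ r then cc r i + cc r (i - 1) else 0
    if i = 0 then 1 else d i + d (i - 1)

/-- The constants attached to the `λ`-rows. -/
def dd (r i : ℕ) : ℚ := if i = 0 then 1 else if i ≤ r then cc r i + cc r (i - 1) else 0

theorem cc_zero (r : ℕ) : cc r 0 = 1 := by
  cases r <;> simp [cc]

theorem dd_zero (r : ℕ) : dd r 0 = 1 := by simp [dd]

theorem cc_succ (r i : ℕ) (hi : i ≠ 0) : cc (r + 1) i = dd r i + dd r (i - 1) := by
  simp only [cc, hi, if_false, dd]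

theorem dd_mid (r i : ℕ) (h1 : 1 ≤ i) (h2 : i ≤ r) : dd r i = cc r i + cc r (i - 1) := by
  simp only [dd, h2, if_true, show i ≠ 0 by omega, if_false]

theorem dd_out (r i : ℕ) (h2 : r < i) : dd r i = 0 := by
  simp only [dd, show ¬ i ≤ r by omega, if_false, show i ≠ 0 by omega]

theorem dd_pos_of (r : ℕ) (h : ∀ i, i ≤ r → 0 < cc r i) (i : ℕ) (hi : i ≤ r) : 0 < dd r i := by
  rcases Nat.eq_zero_or_pos i with rfl | h0
  · simp [dd_zero]
  · rw [dd_mid r i h0 hi]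
    exact add_pos (h i hi) (h (i - 1) (by omega))

theorem cc_pos (r : ℕ) : ∀ i, i ≤ r → 0 < cc r i := by
  induction r with
  | zero => intro i hi; obtain rfl : i = 0 := by omega
            simp [cc_zero]
  | succ r ih =>
    intro i hi
    rcases Nat.eq_zero_or_pos i with rfl | h0
    · simp [cc_zero]
    · rw [cc_succ r i (by omega)]
      have h1 := dd_pos_of r ih (i - 1) (by omega)
      by_cases h2 : i ≤ r
      · have := dd_pos_of r ih i h2
        linarith
      · rw [dd_out r i (by omega)]
        linarith

theorem card_BP (r : ℕ) : ∀ (a : ℕ → ℕ), (∀ i, 1 ≤ i → i ≤ r → a (i + 1) ≤ a i) →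
    a (r + 1) = 0 → Finite (BP r a) ∧
      (Nat.card (BP r a) : ℚ) = ∏ i ∈ Finset.Icc 1 r, cc r i ^ (a i - a (i + 1)) := by
  induction r with
  | zero =>
    intro a _ _
    have : Unique (BP 0 a) :=
      { default := ⟨⟨⟨fun _ _ => 0, fun _ _ => 0, fun _ _ _ => rfl, fun _ _ _ => rfl,
            fun _ _ _ _ _ => by omega, fun _ _ _ _ _ => by omega⟩,
            fun _ _ _ => 0, fun _ _ _ => 0, fun _ _ _ _ _ => by omega, fun _ _ _ _ _ => by omega,
            fun _ _ _ => rfl, fun _ _ _ => rfl⟩, fun _ _ _ => by omega⟩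
        uniq := by
          rintro ⟨Q, hQ⟩
          apply Subtype.ext
          apply RPOP.ext'
          · funext j i; exact Q.eta_supp j i (by omega)
          · funext j i; exact Q.lam_supp j i (by omega)
          · funext i j; exact Q.sbar_supp i j (by omega)
          · funext i j; exact Q.sreg_supp i j (by omega) }
    exact ⟨inferInstance, by simp⟩
  | succ r ih =>
    intro a ha0 hz
    have ha : ∀ i, 1 ≤ i → i ≤ r → a (i + 1) ≤ a i := fun i h1 h2 => ha0 i h1 (by omega)
    let e := Equiv.ofBijective (glueMap ha) ⟨glueMap_injective ha, glueMap_surjective ha⟩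
    have IH : ∀ (p : Step r a) (q : Step r (row p)), Finite (BP r (row q)) ∧
        (Nat.card (BP r (row q)) : ℚ) =
          ∏ i ∈ Finset.Icc 1 r, cc r i ^ (row q i - row q (i + 1)) := fun p q =>
      ih (row q) (row_dec (row_dec ha p) q) (row_out q (r + 1) (by omega))
    have hfin : ∀ (p : Step r a) (q : Step r (row p)), Finite (BP r (row q)) :=
      fun p q => (IH p q).1
    refine ⟨Finite.of_equiv _ e, ?_⟩
    rw [← Nat.card_congr e, Nat.card_sigma]
    simp only [Nat.card_sigma, Nat.cast_sum, (IH _ _).2]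
    have h1 : ∀ p : Step r a, ∑ q : Step r (row p),
        ∏ i ∈ Finset.Icc 1 r, cc r i ^ (row q i - row q (i + 1)) =
          ∏ i ∈ Finset.Icc 1 r, dd r i ^ (row p i - row p (i + 1)) := by
      intro p
      rw [step_sum' r (row p) (cc r) (cc_zero r) (fun i hi => (cc_pos r i hi).ne') (row_dec ha p),
        row_out p (r + 1) (by omega), pow_zero, one_mul]
      apply Finset.prod_congr rfl
      intro i hi
      rw [Finset.mem_Icc] at hi
      rw [dd_mid r i hi.1 hi.2]
    simp only [h1]
    rw [step_sum' r a (dd r) (dd_zero r)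
      (fun i hi => (dd_pos_of r (cc_pos r) i hi).ne') ha, Finset.prod_Icc_succ_top (by omega), hz,
      cc_succ r (r + 1) (by omega), dd_out r (r + 1) (by omega), mul_comm]
    congr 1
    · apply Finset.prod_congr rfl
      intro i hi
      rw [Finset.mem_Icc] at hi
      rw [cc_succ r i (by omega)]
    · simp

/-- The ballot numbers. -/
def bal (n i : ℕ) : ℚ := (n.choose i : ℚ) - (if 2 ≤ i then (n.choose (i - 2) : ℚ) else 0)

theorem bal_succ (n i : ℕ) (hi : 1 ≤ i) : bal (n + 1) i = bal n i + bal n (i - 1) := by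
  obtain ⟨k, rfl⟩ : ∃ k, i = k + 1 := ⟨i - 1, by omega⟩
  rcases k with _ | _ | k
  · simp [bal]
  · simp [bal, Nat.choose_succ_succ n 1]; ring
  · simp only [bal, show 2 ≤ k + 1 + 1 + 1 by omega, show k + 1 + 1 + 1 - 2 = k + 1 by omega,
      show 2 ≤ k + 1 + 1 + 1 - 1 by omega, if_true, show k + 1 + 1 + 1 - 1 - 2 = k by omega,
      show k + 1 + 1 + 1 - 1 = k + 1 + 1 by omega]
    rw [Nat.choose_succ_succ n (k + 1 + 1), Nat.choose_succ_succ n k]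
    push_cast
    ring

theorem cc_formula (r : ℕ) : ∀ i, i ≤ r + 1 → cc (r + 1) i = bal (2 * r + 1) i := by
  induction r with
  | zero =>
    intro i hi
    interval_cases i
    · simp [cc_zero, bal]
    · rw [cc_succ _ _ (by omega)]
      simp [dd, bal]
  | succ r ih =>
    have hd : ∀ i, i ≤ r + 2 → dd (r + 1) i = bal (2 * r + 2) i := by
      intro i hi
      rcases Nat.eq_zero_or_pos i with rfl | h0
      · simp [dd_zero, bal]
      · by_cases h2 : i ≤ r + 1
        · rw [dd_mid _ i h0 h2, bal_succ _ i h0, ih i h2, ih (i - 1) (by omega)]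
        · obtain rfl : i = r + 2 := by omega
          rw [dd_out _ _ (by omega)]
          simp only [bal, show 2 ≤ r + 2 by omega, if_true, Nat.add_sub_cancel]
          rw [Nat.choose_symm_of_eq_add (show 2 * r + 2 = r + 2 + r by ring), sub_self]
    intro i hi
    rcases Nat.eq_zero_or_pos i with rfl | h0
    · simp [cc_zero, bal]
    · rw [cc_succ _ i (by omega), show 2 * (r + 1) + 1 = (2 * r + 2) + 1 by ring,
        bal_succ _ i h0, hd i (by omega), hd (i - 1) (by omega)]

/-- The number of restricted partition overlaid patterns of rank `r` with
bounding sequence `η̲ = (η_1 ≥ ⋯ ≥ η_r ≥ 0)` equals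
`∏_{i=1}^r (C(2r-1, i) - C(2r-1, i-2))^{n_i}` where `n_i = η_i - η_{i+1}` (and
`C(n,k) = 0` for `k < 0`). -/
theorem card_restricted_pops (r : ℕ) (hr : 1 ≤ r) (etab : ℕ → ℕ)
    (hdec : ∀ i, 1 ≤ i → i ≤ r → etab (i + 1) ≤ etab i) (hzero : etab (r + 1) = 0) :
    (Nat.card {Q : RPOP r // Q.toRPattern.Bounds etab} : ℤ) =
      ∏ i ∈ Finset.Icc 1 r,
        (((2 * r - 1).choose i : ℤ) - (if 2 ≤ i then ((2 * r - 1).choose (i - 2) : ℤ) else 0))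
          ^ (etab i - etab (i + 1)) := by
  have h := (card_BP r etab hdec hzero).2
  rw [← Int.cast_inj (α := ℚ)]
  push_cast
  rw [h]
  apply Finset.prod_congr rfl
  intro i hi
  rw [Finset.mem_Icc] at hi
  obtain ⟨k, rfl⟩ : ∃ k, r = k + 1 := ⟨r - 1, by omega⟩
  rw [cc_formula k i hi.2, show 2 * (k + 1) - 1 = 2 * k + 1 by omega, bal]

end SpWeyl
end

section
/- Let r ≥ 1 and let λ̲ = (λ_1 ≥ λ_2 ≥ ⋯ ≥ λ_r ≥ 0) be a weakly decreasing sequence of nonnegative integers; set λ_{r+1} = 0 and m_i = λ_i − λ_{i+1} for 1 ≤ i ≤ r. Then the number of partition overlaid patterns of type C and rank r with bounding sequence λ̲ equals ∏_{i=1}^{r} ( C(2r, i) − C(2r, i−2) )^{m_i}, where C(n,k) denotes the binomial coefficient (with C(n,k) = 0 for k < 0). -/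
namespace SpWeyl

/-- Uniform pattern with rows `0, …, k`, row `j` having length `(j+1)/2`. -/
structure IsG (k : ℕ) (mu : ℕ → ℕ) (p : (ℕ → ℕ → ℕ) × (ℕ → ℕ → ℕ → ℕ)) : Prop where
  top : p.1 k = mu
  ineq : ∀ j i, j < k → 1 ≤ i → i ≤ (j + 1) / 2 →
    p.1 j i ≤ p.1 (j + 1) i ∧ p.1 (j + 1) (i + 1) ≤ p.1 j i
  fits : ∀ j i, j < k → 1 ≤ i → i ≤ (j + 1) / 2 →
    FitsRect (p.1 (j + 1) i - p.1 j i) (p.1 j i - p.1 (j + 1) (i + 1)) (p.2 j i)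
  row_supp : ∀ j i, ¬ (j ≤ k ∧ 1 ≤ i ∧ i ≤ (j + 1) / 2) → p.1 j i = 0
  s_supp : ∀ j i, ¬ (j < k ∧ 1 ≤ i ∧ i ≤ (j + 1) / 2) → p.2 j i = fun _ => 0

/-- Extension of a finite row by zero. -/
def rowExt {L : ℕ} {α : Type*} (z : α) (f : Fin L → α) (i : ℕ) : α :=
  if h : 1 ≤ i ∧ i ≤ L then f ⟨i - 1, by omega⟩ else z

theorem rowExt_succ {L : ℕ} {α : Type*} (z : α) (f : Fin L → α) (i : Fin L) :
    rowExt z f (i + 1) = f i := by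
  unfold rowExt
  rw [dif_pos ⟨by omega, by omega⟩]
  rfl

theorem rowExt_in {L : ℕ} {α : Type*} (z : α) (f : Fin L → α) (i : ℕ) (h1 : 1 ≤ i) (h2 : i ≤ L) :
    rowExt z f i = f ⟨i - 1, by omega⟩ := by
  unfold rowExt
  rw [dif_pos ⟨h1, h2⟩]

theorem rowExt_out {L : ℕ} {α : Type*} (z : α) (f : Fin L → α) (i : ℕ) (h : ¬ (1 ≤ i ∧ i ≤ L)) :
    rowExt z f i = z := by
  unfold rowExt
  rw [dif_neg h]

theorem rowExt_self {L : ℕ} {α : Type*} (z : α) (g : ℕ → α)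
    (h : ∀ i, ¬ (1 ≤ i ∧ i ≤ L) → g i = z) :
    rowExt z (fun i : Fin L => g (i + 1)) = g := by
  funext i
  by_cases hi : 1 ≤ i ∧ i ≤ L
  · rw [rowExt_in _ _ _ hi.1 hi.2]
    simp only
    congr 1
    omega
  · rw [rowExt_out _ _ _ hi, h i hi]

/-- Possible rows below `mu`. -/
abbrev below (k : ℕ) (mu : ℕ → ℕ) : Finset (Fin ((k + 1) / 2) → ℕ) :=
  Fintype.piFinset (fun i : Fin ((k + 1) / 2) => Finset.Icc (mu (i + 1 + 1)) (mu (i + 1)))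

/-- The recursion for uniform patterns. -/
def stepEquiv (k : ℕ) (mu : ℕ → ℕ) (hmu : ∀ i, ¬ (1 ≤ i ∧ i ≤ (k + 2) / 2) → mu i = 0) :
    {p // IsG (k + 1) mu p} ≃
      Σ f : below k mu, (∀ i : Fin ((k + 1) / 2),
        {s : ℕ → ℕ // FitsRect (mu (i + 1) - f.1 i) (f.1 i - mu (i + 1 + 1)) s}) ×
        {p // IsG k (rowExt 0 f.1) p} where
  toFun p := ⟨⟨fun i => p.1.1 k (i + 1), by
      obtain ⟨p, hp⟩ := p
      rw [Fintype.mem_piFinset]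
      intro i
      have := hp.ineq k (i + 1) (by omega) (by omega) (by omega)
      rw [hp.top] at this
      exact Finset.mem_Icc.2 ⟨this.2, this.1⟩⟩,
    fun i => ⟨p.1.2 k (i + 1), by
      obtain ⟨p, hp⟩ := p
      have := hp.fits k (i + 1) (by omega) (by omega) (by omega)
      rw [hp.top] at this
      exact this⟩,
    ⟨(fun j => if j ≤ k then p.1.1 j else fun _ => 0,
      fun j => if j < k then p.1.2 j else fun _ _ => 0), by
      obtain ⟨p, hp⟩ := p
      constructor
      · simp only [le_refl, if_true]
        rw [rowExt_self]
        intro i hi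
        exact hp.row_supp k i (by omega)
      · intro j i hj h1 h2
        simp only [if_pos (show j ≤ k by omega), if_pos (show j + 1 ≤ k by omega)]
        exact hp.ineq j i (by omega) h1 h2
      · intro j i hj h1 h2
        simp only [if_pos (show j ≤ k by omega), if_pos (show j + 1 ≤ k by omega), if_pos hj]
        exact hp.fits j i (by omega) h1 h2
      · intro j i h
        by_cases hj : j ≤ k
        · simp only [if_pos hj]
          exact hp.row_supp j i (by omega)
        · simp only [if_neg hj]
      · intro j i h
        by_cases hj : j < k
        · simp only [if_pos hj]
          exact hp.s_supp j i (by omega)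
        · simp only [if_neg hj]⟩⟩
  invFun q := ⟨(fun j => if j = k + 1 then mu else q.2.2.1.1 j,
      fun j => if j = k then rowExt (fun _ => 0) (fun i => (q.2.1 i).1) else q.2.2.1.2 j), by
      obtain ⟨⟨f, hf⟩, t, ⟨p, hp⟩⟩ := q
      rw [Fintype.mem_piFinset] at hf
      constructor
      · simp only [if_true]
      · intro j i hj h1 h2
        by_cases hjk : j = k
        · subst hjk
          simp only [if_true, if_neg (show ¬ j = j + 1 by omega)]
          rw [hp.top]
          simp only
          rw [rowExt_in _ _ _ h1 h2]
          have := hf ⟨i - 1, by omega⟩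
          simp only [Finset.mem_Icc] at this
          rw [show i - 1 + 1 = i by omega] at this
          exact ⟨this.2, this.1⟩
        · simp only [if_neg (show ¬ j + 1 = k + 1 by omega), if_neg (show ¬ j = k + 1 by omega)]
          exact hp.ineq j i (by omega) h1 h2
      · intro j i hj h1 h2
        by_cases hjk : j = k
        · subst hjk
          simp only [if_true, if_neg (show ¬ j = j + 1 by omega)]
          rw [hp.top]
          simp only
          rw [rowExt_in _ _ _ h1 h2, rowExt_in _ _ _ h1 h2]
          have := (t ⟨i - 1, by omega⟩).2
          simp only [show i - 1 + 1 = i by omega] at this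
          exact this
        · simp only [if_neg (show ¬ j + 1 = k + 1 by omega), if_neg (show ¬ j = k + 1 by omega),
            if_neg hjk]
          exact hp.fits j i (by omega) h1 h2
      · intro j i h
        by_cases hj : j = k + 1
        · simp only [if_pos hj]
          exact hmu i (by omega)
        · simp only [if_neg hj]
          exact hp.row_supp j i (by omega)
      · intro j i h
        by_cases hj : j = k
        · simp only [if_pos hj]
          exact rowExt_out _ _ _ (by omega)
        · simp only [if_neg hj]
          exact hp.s_supp j i (by omega)⟩
  left_inv p := by
    obtain ⟨⟨a, b⟩, hp⟩ := p
    apply Subtype.ext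
    apply Prod.ext
    · funext j
      simp only
      split_ifs with h1 h2
      · rw [h1]; exact hp.top.symm
      · rfl
      · funext i
        exact (hp.row_supp j i (by omega)).symm
    · funext j
      simp only
      split_ifs with h1 h2
      · subst h1
        rw [rowExt_self (fun _ => 0) (b j)]
        intro i hi
        exact hp.s_supp j i (by omega)
      · rfl
      · funext i
        exact (hp.s_supp j i (by omega)).symm
  right_inv q := by
    obtain ⟨⟨f, hf⟩, t, ⟨⟨a, b⟩, hp⟩⟩ := q
    have ht := hp.top
    simp only at ht
    have hf' : (fun i : Fin ((k + 1) / 2) =>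
        (if k = k + 1 then mu else a k) ((i : ℕ) + 1)) = f := by
      funext i
      rw [if_neg (by omega), ht, rowExt_succ]
    have key : ∀ (f' : Fin ((k + 1) / 2) → ℕ) (hff : f' = f) (h1 : f' ∈ below k mu)
        (t' : ∀ i : Fin ((k + 1) / 2),
          {s : ℕ → ℕ // FitsRect (mu (i + 1) - f' i) (f' i - mu (i + 1 + 1)) s})
        (p' : {p // IsG k (rowExt 0 f') p}), (∀ i, (t' i).1 = (t i).1) → p'.1 = (a, b) →
        (⟨⟨f', h1⟩, t', p'⟩ : Σ f : below k mu, (∀ i : Fin ((k + 1) / 2),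
        {s : ℕ → ℕ // FitsRect (mu (i + 1) - f.1 i) (f.1 i - mu (i + 1 + 1)) s}) ×
        {p // IsG k (rowExt 0 f.1) p}) = ⟨⟨f, hf⟩, t, ⟨(a, b), hp⟩⟩ := by
      intro f' hff
      subst hff
      intro h1 t' p' h2 h3
      have e1 : t' = t := funext fun i => Subtype.ext (h2 i)
      have e2 : p' = ⟨(a, b), hp⟩ := Subtype.ext h3
      rw [e1, e2]
    apply key _ hf'
    · intro i
      simp only [if_true]
      exact rowExt_succ _ _ i
    · apply Prod.ext
      · funext j
        simp only
        split_ifs with h1 h2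
        · omega
        · rfl
        · funext i
          exact (hp.row_supp j i (by omega)).symm
      · funext j
        simp only
        split_ifs with h1 h2
        · omega
        · rfl
        · funext i
          exact (hp.s_supp j i (by omega)).symm

/-- Dimension-like numbers. -/
def dimD (k i : ℕ) : ℤ := (k.choose i : ℤ) - (if 2 ≤ i then (k.choose (i - 2) : ℤ) else 0)

theorem dimD_zero (k : ℕ) : dimD k 0 = 1 := by simp [dimD]

theorem dimD_succ (k i : ℕ) : dimD (k + 1) (i + 1) = dimD k (i + 1) + dimD k i := by
  rcases i with _ | _ | i
  · simp [dimD]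
  · simp [dimD, Nat.choose_succ_succ]
    ring
  · simp [dimD, Nat.choose_succ_succ]
    ring

theorem dimD_mid (L : ℕ) : dimD (2 * L) (L + 1) = 0 := by
  rcases L with _ | L
  · simp [dimD]
  · simp only [dimD]
    rw [if_pos (by omega), show L + 1 + 1 - 2 = L by omega]
    rw [← Nat.choose_symm_of_eq_add (show 2 * (L + 1) = L + (L + 1 + 1) by ring)]
    simp

theorem prod_shift (x : ℕ → ℤ) (mu nu : ℕ → ℕ) (n : ℕ)
    (h1 : ∀ i, i < n → mu (i + 1 + 1) ≤ nu (i + 1)) (h2 : ∀ i, i ≤ n → nu (i + 1) ≤ mu (i + 1)) :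
    (∏ i ∈ Finset.range n, x (i + 1) ^ (nu (i + 1) - nu (i + 1 + 1))) * x 0 ^ (mu 1 - nu 1) =
    (∏ i ∈ Finset.range n,
      (x (i + 1) ^ (nu (i + 1) - mu (i + 1 + 1)) * x i ^ (mu (i + 1) - nu (i + 1)))) *
      x n ^ (mu (n + 1) - nu (n + 1)) := by
  induction n with
  | zero => simp
  | succ n ih =>
    have ih := ih (fun i hi => h1 i (by omega)) (fun i hi => h2 i (by omega))
    rw [Finset.prod_range_succ, Finset.prod_range_succ, mul_right_comm, ih]
    have a1 := h1 n (by omega)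
    have a2 := h2 (n + 1) (by omega)
    rw [show nu (n + 1) - nu (n + 1 + 1) =
      (nu (n + 1) - mu (n + 1 + 1)) + (mu (n + 1 + 1) - nu (n + 1 + 1)) by omega, pow_add]
    ring

theorem sum_Icc_binom (x y : ℤ) (a b : ℕ) (h : a ≤ b) :
    ∑ v ∈ Finset.Icc a b, ((b - a).choose (b - v) : ℤ) * (x ^ (v - a) * y ^ (b - v)) =
      (x + y) ^ (b - a) := by
  rw [add_pow]
  refine Finset.sum_bij' (fun v _ => v - a) (fun m _ => m + a) ?_ ?_ ?_ ?_ ?_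
  · intro v hv; simp only [Finset.mem_Icc, Finset.mem_range] at *; omega
  · intro v hv; simp only [Finset.mem_Icc, Finset.mem_range] at *; omega
  · intro v hv; simp only [Finset.mem_Icc] at *; omega
  · intro v hv; simp
  · intro v hv
    simp only [Finset.mem_Icc] at hv
    rw [show b - a - (v - a) = b - v by omega]
    rw [Nat.choose_symm_of_eq_add (show b - a = (b - v) + (v - a) by omega)]
    ring

theorem card_G (k : ℕ) (mu : ℕ → ℕ) (hmu : ∀ i, ¬ (1 ≤ i ∧ i ≤ (k + 1) / 2) → mu i = 0)
    (hdec : ∀ i, 1 ≤ i → mu (i + 1) ≤ mu i) :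
    Finite {p // IsG k mu p} ∧ (Nat.card {p // IsG k mu p} : ℤ) =
      ∏ i ∈ Finset.range ((k + 1) / 2), dimD k (i + 1) ^ (mu (i + 1) - mu (i + 1 + 1)) := by
  induction k generalizing mu with
  | zero =>
    have hu : Nat.card {p // IsG 0 mu p} = 1 := by
      rw [Nat.card_eq_one_iff_unique]
      refine ⟨⟨fun p q => ?_⟩, ⟨⟨(fun _ _ => 0, fun _ _ _ => 0), ?_⟩⟩⟩
      · obtain ⟨⟨a, b⟩, hp⟩ := p
        obtain ⟨⟨c, d⟩, hq⟩ := q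
        apply Subtype.ext
        apply Prod.ext
        · funext j i
          exact (hp.row_supp j i (by omega)).trans (hq.row_supp j i (by omega)).symm
        · funext j i
          exact (hp.s_supp j i (by omega)).trans (hq.s_supp j i (by omega)).symm
      · constructor
        · funext i
          exact (hmu i (by omega)).symm
        · intro j i hj; omega
        · intro j i hj; omega
        · intro j i _; rfl
        · intro j i _; rfl
    refine ⟨Nat.finite_of_card_ne_zero (by omega), ?_⟩
    rw [hu]
    simp
  | succ k ih =>
    have key : ∀ f : below k mu, (∀ i, ¬ (1 ≤ i ∧ i ≤ (k + 1) / 2) → rowExt 0 f.1 i = 0) ∧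
        (∀ i, 1 ≤ i → rowExt 0 f.1 (i + 1) ≤ rowExt 0 f.1 i) ∧
        (∀ i, 1 ≤ i → rowExt 0 f.1 i ≤ mu i) ∧
        (∀ i, 1 ≤ i → i ≤ (k + 1) / 2 → mu (i + 1) ≤ rowExt 0 f.1 i) := by
      rintro ⟨f, hf⟩
      rw [Fintype.mem_piFinset] at hf
      have c1 : ∀ i, ¬ (1 ≤ i ∧ i ≤ (k + 1) / 2) → rowExt 0 f i = 0 :=
        fun i hi => rowExt_out _ _ _ hi
      have c2 : ∀ i, 1 ≤ i → rowExt 0 f i ≤ mu i := by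
        intro i hi
        by_cases h : i ≤ (k + 1) / 2
        · rw [rowExt_in _ _ _ hi h]
          have := hf ⟨i - 1, by omega⟩
          simp only [Finset.mem_Icc, show i - 1 + 1 = i by omega] at this
          exact this.2
        · rw [c1 i (by omega)]; exact Nat.zero_le _
      have c3 : ∀ i, 1 ≤ i → i ≤ (k + 1) / 2 → mu (i + 1) ≤ rowExt 0 f i := by
        intro i hi h
        rw [rowExt_in _ _ _ hi h]
        have := hf ⟨i - 1, by omega⟩
        simp only [Finset.mem_Icc, show i - 1 + 1 = i by omega] at this
        exact this.1
      refine ⟨c1, fun i hi => ?_, c2, c3⟩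
      by_cases h : i ≤ (k + 1) / 2
      · exact (c2 (i + 1) (by omega)).trans (c3 i hi h)
      · change rowExt 0 f (i + 1) ≤ _
        rw [c1 (i + 1) (by omega)]; exact Nat.zero_le _
    have e := stepEquiv k mu hmu
    have hfin : ∀ f : below k mu, Finite {p // IsG k (rowExt 0 f.1) p} :=
      fun f => (ih _ (key f).1 (key f).2.1).1
    refine ⟨Finite.of_equiv _ e.symm, ?_⟩
    rw [Nat.card_congr e, Nat.card_sigma]
    push_cast
    have hterm : ∀ f : below k mu, ((Nat.card ((∀ i : Fin ((k + 1) / 2),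
        {s : ℕ → ℕ // FitsRect (mu (i + 1) - f.1 i) (f.1 i - mu (i + 1 + 1)) s}) ×
        {p // IsG k (rowExt 0 f.1) p}) : ℕ) : ℤ) =
        (∏ i : Fin ((k + 1) / 2),
          (((mu (i + 1) - mu (i + 1 + 1)).choose (mu (i + 1) - f.1 i) : ℤ) *
          (dimD k (i + 1) ^ (f.1 i - mu (i + 1 + 1)) * dimD k i ^ (mu (i + 1) - f.1 i)))) *
          dimD k ((k + 1) / 2) ^ mu ((k + 1) / 2 + 1) := by
      intro f
      obtain ⟨c1, c2, c3, c4⟩ := key f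
      rw [Nat.card_prod, Nat.card_pi]
      push_cast
      rw [(ih _ c1 c2).2]
      have hs := prod_shift (dimD k) mu (rowExt 0 f.1) ((k + 1) / 2)
        (fun i hi => c4 (i + 1) (by omega) (by omega)) (fun i _ => c3 (i + 1) (by omega))
      rw [dimD_zero, one_pow, mul_one] at hs
      rw [hs, c1 ((k + 1) / 2 + 1) (by omega), Nat.sub_zero, ← mul_assoc]
      congr 1
      rw [Finset.prod_range, ← Finset.prod_mul_distrib]
      refine Finset.prod_congr rfl fun i _ => ?_
      have d3 := c3 (i + 1) (by omega)
      have d4 := c4 (i + 1) (by omega) (by omega)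
      rw [rowExt_succ] at d3 d4 ⊢
      rw [fitsRect_card]
      rw [show mu (i + 1) - f.1 i + (f.1 i - mu (i + 1 + 1)) = mu (i + 1) - mu (i + 1 + 1) by omega]
    rw [Finset.sum_congr rfl fun f _ => hterm f, ← Finset.sum_mul]
    rw [Finset.sum_coe_sort (below k mu) (fun f => ∏ i : Fin ((k + 1) / 2),
          (((mu (i + 1) - mu (i + 1 + 1)).choose (mu (i + 1) - f i) : ℤ) *
          (dimD k (i + 1) ^ (f i - mu (i + 1 + 1)) * dimD k i ^ (mu (i + 1) - f i))))]
    rw [← Finset.prod_univ_sum (fun i : Fin ((k + 1) / 2) =>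
        Finset.Icc (mu (i + 1 + 1)) (mu (i + 1)))
      (fun i v => (((mu (i + 1) - mu (i + 1 + 1)).choose (mu (i + 1) - v) : ℤ) *
          (dimD k (i + 1) ^ (v - mu (i + 1 + 1)) * dimD k i ^ (mu (i + 1) - v))))]
    rw [Finset.prod_congr rfl fun (i : Fin ((k + 1) / 2)) _ =>
      sum_Icc_binom (dimD k (i + 1)) (dimD k i) (mu (i + 1 + 1)) (mu (i + 1))
        (hdec _ (by omega))]
    rw [← Finset.prod_range (fun i => (dimD k (i + 1) + dimD k i) ^ (mu (i + 1) - mu (i + 1 + 1)))]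
    simp only [← dimD_succ]
    rcases Nat.even_or_odd' k with ⟨c, hc | hc⟩
    · rw [show (k + 1 + 1) / 2 = (k + 1) / 2 + 1 by omega, Finset.prod_range_succ]
      congr 1
      rw [hmu ((k + 1) / 2 + 1 + 1) (by omega), dimD_succ]
      rw [show (k + 1) / 2 = c by omega, hc, dimD_mid, zero_add, Nat.sub_zero]
    · rw [show (k + 1 + 1) / 2 = (k + 1) / 2 by omega, hmu ((k + 1) / 2 + 1) (by omega)]
      simp

theorem PatternC.lam_nonneg {r : ℕ} (P : PatternC r) (j i : ℕ) : 0 ≤ P.lam j i := by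
  by_cases hj : j ≤ r
  · have : ∀ n i, 1 ≤ i → i + n = j + 1 → 0 ≤ P.lam j i := by
      intro n
      induction n with
      | zero => intro i h1 h; rw [P.lam_supp j i (by omega)]
      | succ n ih =>
        intro i h1 h
        have := P.ineq1 j i h1 (by omega) hj
        have := ih (i + 1) (by omega) (by omega)
        omega
    by_cases hi : 1 ≤ i ∧ i ≤ j
    · exact this (j + 1 - i) i hi.1 (by omega)
    · rw [P.lam_supp j i (by omega)]
  · rw [P.lam_supp j i (by omega)]

theorem PatternC.eta_nonneg {r : ℕ} (P : PatternC r) (j i : ℕ) : 0 ≤ P.eta j i := by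
  by_cases h : 1 ≤ i ∧ i ≤ j ∧ j ≤ r
  · exact (P.lam_nonneg j (i + 1)).trans (P.ineq1 j i h.1 h.2.1 h.2.2).2
  · rw [P.eta_supp j i h]

theorem popc_ext {r : ℕ} (P Q : POPC r) (h1 : P.eta = Q.eta) (h2 : P.lam = Q.lam)
    (h3 : P.sbar = Q.sbar) (h4 : P.sreg = Q.sreg) : P = Q := by
  obtain ⟨⟨a, b, _, _, _, _⟩, c, d, _, _, _, _⟩ := P
  obtain ⟨⟨a', b', _, _, _, _⟩, c', d', _, _, _, _⟩ := Q
  simp only at h1 h2 h3 h4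
  subst h1 h2 h3 h4
  rfl

/-- The bounding row, normalised. -/
def normRow (r : ℕ) (lamb : ℕ → ℕ) (i : ℕ) : ℕ := if 1 ≤ i ∧ i ≤ r then lamb i else 0

/-- Data of the uniform pattern attached to a POP. -/
def popRow {r : ℕ} (P : POPC r) (k i : ℕ) : ℕ :=
  if k % 2 = 0 then (P.lam (k / 2) i).toNat else (P.eta ((k + 1) / 2) i).toNat

/-- Overlay of the uniform pattern attached to a POP. -/
def popS {r : ℕ} (P : POPC r) (k i : ℕ) : ℕ → ℕ :=
  if k % 2 = 0 then P.sreg i (k / 2) else P.sbar i ((k + 1) / 2)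

theorem popRow_even {r : ℕ} (P : POPC r) (j i : ℕ) : popRow P (2 * j) i = (P.lam j i).toNat := by
  unfold popRow
  rw [if_pos (by omega), show 2 * j / 2 = j by omega]

theorem popRow_odd {r : ℕ} (P : POPC r) (j i : ℕ) :
    popRow P (2 * j + 1) i = (P.eta (j + 1) i).toNat := by
  unfold popRow
  rw [if_neg (by omega), show (2 * j + 1 + 1) / 2 = j + 1 by omega]

theorem popS_even {r : ℕ} (P : POPC r) (j i : ℕ) : popS P (2 * j) i = P.sreg i j := by
  unfold popS
  rw [if_pos (by omega), show 2 * j / 2 = j by omega]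

theorem popS_odd {r : ℕ} (P : POPC r) (j i : ℕ) : popS P (2 * j + 1) i = P.sbar i (j + 1) := by
  unfold popS
  rw [if_neg (by omega), show (2 * j + 1 + 1) / 2 = j + 1 by omega]

theorem isG_pop {r : ℕ} (P : POPC r) (lamb : ℕ → ℕ) (hP : P.toPatternC.Bounds lamb) :
    IsG (2 * r) (normRow r lamb) (popRow P, popS P) := by
  have hl := P.toPatternC.lam_nonneg
  have he := P.toPatternC.eta_nonneg
  constructor
  · funext i
    simp only [popRow_even, normRow]
    split_ifs with h
    · rw [hP i h.1 h.2]; simp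
    · rw [P.lam_supp r i (by omega)]; rfl
  · intro k i hk h1 h2
    simp only
    rcases Nat.even_or_odd' k with ⟨j, rfl | rfl⟩
    · simp only [popRow_even, popRow_odd]
      have := P.ineq2 j i h1 (by omega) (by omega)
      omega
    · simp only [show 2 * j + 1 + 1 = 2 * (j + 1) by ring, popRow_even, popRow_odd]
      have := P.ineq1 (j + 1) i h1 (by omega) (by omega)
      omega
  · intro k i hk h1 h2
    simp only
    rcases Nat.even_or_odd' k with ⟨j, rfl | rfl⟩
    · simp only [popRow_even, popRow_odd, popS_even]
      have := P.sreg_fits i j h1 (by omega) (by omega)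
      have a1 := hl j i
      have a2 := he (j + 1) i
      have a3 := he (j + 1) (i + 1)
      unfold PatternC.lreg PatternC.lreg' at this
      convert this using 1 <;> omega
    · simp only [show 2 * j + 1 + 1 = 2 * (j + 1) by ring, popRow_even, popRow_odd, popS_odd]
      have := P.sbar_fits i (j + 1) h1 (by omega) (by omega)
      have a1 := hl (j + 1) i
      have a2 := hl (j + 1) (i + 1)
      have a3 := he (j + 1) i
      unfold PatternC.lbar PatternC.lbar' at this
      convert this using 1 <;> omega
  · intro k i h
    simp only
    rcases Nat.even_or_odd' k with ⟨j, rfl | rfl⟩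
    · rw [popRow_even, P.lam_supp j i (by omega)]; rfl
    · rw [popRow_odd, P.eta_supp (j + 1) i (by omega)]; rfl
  · intro k i h
    simp only
    rcases Nat.even_or_odd' k with ⟨j, rfl | rfl⟩
    · rw [popS_even, P.sreg_supp i j (by omega)]
    · rw [popS_odd, P.sbar_supp i (j + 1) (by omega)]

/-- The POP attached to a uniform pattern. -/
def popOf {r : ℕ} {mu : ℕ → ℕ} {p : (ℕ → ℕ → ℕ) × (ℕ → ℕ → ℕ → ℕ)} (hp : IsG (2 * r) mu p) :
    POPC r where
  eta j i := (p.1 (2 * j - 1) i : ℤ)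
  lam j i := (p.1 (2 * j) i : ℤ)
  sbar i j := p.2 (2 * j - 1) i
  sreg i j := p.2 (2 * j) i
  eta_supp j i h := by
    rw [hp.row_supp (2 * j - 1) i (by omega)]; rfl
  lam_supp j i h := by
    rw [hp.row_supp (2 * j) i (by omega)]; rfl
  ineq1 j i h1 h2 h3 := by
    have := hp.ineq (2 * j - 1) i (by omega) h1 (by omega)
    rw [show 2 * j - 1 + 1 = 2 * j by omega] at this
    omega
  ineq2 j i h1 h2 h3 := by
    have := hp.ineq (2 * j) i (by omega) h1 (by omega)
    rw [show 2 * (j + 1) - 1 = 2 * j + 1 by omega]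
    omega
  sbar_fits i j h1 h2 h3 := by
    have := hp.fits (2 * j - 1) i (by omega) h1 (by omega)
    rw [show 2 * j - 1 + 1 = 2 * j by omega] at this
    unfold PatternC.lbar PatternC.lbar'
    simp only
    convert this using 1 <;> omega
  sreg_fits i j h1 h2 h3 := by
    have := hp.fits (2 * j) i (by omega) h1 (by omega)
    unfold PatternC.lreg PatternC.lreg'
    simp only [show 2 * (j + 1) - 1 = 2 * j + 1 by omega]
    convert this using 1 <;> omega
  sbar_supp i j h := hp.s_supp _ _ (by omega)
  sreg_supp i j h := hp.s_supp _ _ (by omega)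

/-- POPs are the same as uniform patterns. -/
def popEquiv (r : ℕ) (lamb : ℕ → ℕ) :
    {P : POPC r // P.toPatternC.Bounds lamb} ≃ {p // IsG (2 * r) (normRow r lamb) p} where
  toFun P := ⟨(popRow P.1, popS P.1), isG_pop P.1 lamb P.2⟩
  invFun p := ⟨popOf p.2, by
    intro i h1 h2
    change ((p.1.1 (2 * r) i : ℕ) : ℤ) = _
    rw [p.2.top, normRow, if_pos ⟨h1, h2⟩]⟩
  left_inv P := by
    obtain ⟨P, hP⟩ := P
    have hl := P.toPatternC.lam_nonneg
    have he := P.toPatternC.eta_nonneg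
    apply Subtype.ext
    apply popc_ext
    · funext j i
      change ((popRow P (2 * j - 1) i : ℕ) : ℤ) = _
      rcases j with _ | j
      · rw [P.eta_supp 0 i (by omega), show 2 * 0 - 1 = 2 * 0 by rfl, popRow_even,
          P.lam_supp 0 i (by omega)]
        rfl
      · rw [show 2 * (j + 1) - 1 = 2 * j + 1 by omega, popRow_odd, Int.toNat_of_nonneg (he _ _)]
    · funext j i
      change ((popRow P (2 * j) i : ℕ) : ℤ) = _
      rw [popRow_even, Int.toNat_of_nonneg (hl _ _)]
    · funext i j
      change popS P (2 * j - 1) i = _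
      rcases j with _ | j
      · rw [P.sbar_supp i 0 (by omega), show 2 * 0 - 1 = 2 * 0 by rfl, popS_even,
          P.sreg_supp i 0 (by omega)]
      · rw [show 2 * (j + 1) - 1 = 2 * j + 1 by omega, popS_odd]
    · funext i j
      exact popS_even P j i
  right_inv p := by
    obtain ⟨⟨a, b⟩, hp⟩ := p
    apply Subtype.ext
    apply Prod.ext
    · funext k i
      change popRow (popOf hp) k i = a k i
      rcases Nat.even_or_odd' k with ⟨j, rfl | rfl⟩
      · rw [popRow_even]; rfl
      · rw [popRow_odd]; rfl
    · funext k i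
      change popS (popOf hp) k i = b k i
      rcases Nat.even_or_odd' k with ⟨j, rfl | rfl⟩
      · rw [popS_even]; rfl
      · rw [popS_odd]; rfl

/-- The number of partition overlaid patterns of type `C` and rank `r` with
bounding sequence `λ̲ = (λ_1 ≥ ⋯ ≥ λ_r ≥ 0)` equals
`∏_{i=1}^r (C(2r, i) - C(2r, i-2))^{m_i}` where `m_i = λ_i - λ_{i+1}` (and `C(n,k) = 0`
for `k < 0`). -/
theorem card_pops (r : ℕ) (hr : 1 ≤ r) (lamb : ℕ → ℕ)
    (hdec : ∀ i, 1 ≤ i → i ≤ r → lamb (i + 1) ≤ lamb i) (hzero : lamb (r + 1) = 0) :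
    (Nat.card {P : POPC r // P.toPatternC.Bounds lamb} : ℤ) =
      ∏ i ∈ Finset.Icc 1 r,
        (((2 * r).choose i : ℤ) - (if 2 ≤ i then ((2 * r).choose (i - 2) : ℤ) else 0))
          ^ (lamb i - lamb (i + 1)) := by
  have hG := (card_G (2 * r) (normRow r lamb)
    (fun i hi => if_neg (by omega)) (fun i hi => by
      unfold normRow
      split_ifs
      · exact hdec i (by omega) (by omega)
      · omega
      · exact Nat.zero_le _
      · exact Nat.zero_le _)).2
  rw [Nat.card_congr (popEquiv r lamb), hG, show (2 * r + 1) / 2 = r by omega]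
  rw [Finset.range_eq_Ico, Finset.prod_Ico_add' (fun i => dimD (2 * r) i ^
    (normRow r lamb i - normRow r lamb (i + 1))) 0 r 1]
  refine Finset.prod_congr ?_ ?_
  · ext i
    simp only [Finset.mem_Ico, Finset.mem_Icc]
    omega
  · intro i hi
    simp only [Finset.mem_Icc] at hi
    have h1 : normRow r lamb i = lamb i := if_pos hi
    have h2 : normRow r lamb (i + 1) = lamb (i + 1) := by
      unfold normRow
      split_ifs with h
      · rfl
      · rw [show i = r by omega, hzero]
    rw [h1, h2]
    rfl

end SpWeyl
end

section
/- Let r ≥ 2 and let η̲ = (η_1 ≥ ⋯ ≥ η_r ≥ 0), η_{r+1} = 0, n_i = η_i − η_{i+1}. There is an explicit bijection between the set of restricted partition overlaid patterns of rank r with bounding sequence η̲ and the set of pairs ((ℓ̲′, s̲′), Q), where ℓ̲′ = (ℓ′_1,…,ℓ′_{r−1}) ∈ ℕ^{r−1} with ℓ′_i ≤ n_i for all 1 ≤ i < r, s̲′ = (s′_1,…,s′_{r−1}) with each s′_i a partition fitting into the rectangle (ℓ′_i, n_i − ℓ′_i), and Q is a POP of type C and rank r−1 with bounding sequence (η_1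 − ℓ′_1, …, η_{r−1} − ℓ′_{r−1}). The bijection sends a restricted POP to the pair obtained by setting ℓ′_i = ℓ_{i,r−1} = η^r_i − λ^{r−1}_i and s′_i = s_{i,r−1}, and letting Q be the POP of rank r−1 obtained by deleting the top restricted row η^r and the partitions s_{i,r−1}. -/
namespace SpWeyl

/-- The data `(ℓ̲′, s̲′)` of Statement 4: `ℓ̲′ = (ℓ′_1, …, ℓ′_{r-1}) ∈ ℕ^{r-1}` with
`ℓ′_i ≤ n_i`, and `s̲′ = (s′_1, …, s′_{r-1})` with `s′_i` a partition fitting into the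
rectangle `(ℓ′_i, n_i − ℓ′_i)` (all data normalized to vanish outside `1 ≤ i ≤ r-1`). -/
structure RectData' (r : ℕ) (n : ℕ → ℕ) where
  l : ℕ → ℕ
  s : ℕ → ℕ → ℕ
  l_le : ∀ i, 1 ≤ i → i < r → l i ≤ n i
  l_supp : ∀ i, ¬(1 ≤ i ∧ i < r) → l i = 0
  s_fits : ∀ i, 1 ≤ i → i < r → FitsRect (l i) (n i - l i) (s i)
  s_supp : ∀ i, ¬(1 ≤ i ∧ i < r) → s i = fun _ => 0

/-- Forward map: the data `(ℓ̲′, s̲′)` read off from the top of a restricted POP. -/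
def fwdRect (r : ℕ) (hr : 2 ≤ r) (etab : ℕ → ℕ) (P : RPOP r)
    (hP : P.toRPattern.Bounds etab) : RectData' r (fun i => etab i - etab (i + 1)) where
  l i := if 1 ≤ i ∧ i < r then P.toRPattern.lreg i (r - 1) else 0
  s i := if 1 ≤ i ∧ i < r then P.sreg i (r - 1) else fun _ => 0
  l_le i h1 h2 := by
    have h := P.ineq2 (r - 1) i h1 (by omega) (by omega)
    have hb := hP i h1 (by omega)
    have hb' := hP (i + 1) (by omega) (by omega)
    have e : r - 1 + 1 = r := by omega
    rw [e] at h
    simp only [h1, h2, and_self, if_true, RPattern.lreg, e]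
    omega
  l_supp i h := if_neg h
  s_fits i h1 h2 := by
    have h := P.ineq2 (r - 1) i h1 (by omega) (by omega)
    have hb := hP i h1 (by omega)
    have hb' := hP (i + 1) (by omega) (by omega)
    have e : r - 1 + 1 = r := by omega
    have hf := P.sreg_fits i (r - 1) h1 (by omega) (by omega)
    have e2 : P.toRPattern.lreg' i (r - 1)
        = etab i - etab (i + 1) - P.toRPattern.lreg i (r - 1) := by
      simp only [RPattern.lreg, RPattern.lreg', e]
      rw [e] at h
      omega
    simp only [h1, h2, and_self, if_true]
    rw [← e2]
    exact hf
  s_supp i h := if_neg h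

/-- Forward map: the POP of rank `r - 1` obtained by deleting the top row. -/
def fwdPOP (r : ℕ) (hr : 2 ≤ r) (P : RPOP r) : POPC (r - 1) where
  eta j i := if j ≤ r - 1 then P.eta j i else 0
  lam := P.lam
  eta_supp j i h := by
    by_cases hj : j ≤ r - 1
    · rw [if_pos hj]; exact P.eta_supp j i (by omega)
    · rw [if_neg hj]
  lam_supp j i h := P.lam_supp j i (by omega)
  ineq1 j i h1 h2 h3 := by
    rw [if_pos h3]; exact P.ineq1 j i h1 h2 (by omega)
  ineq2 j i h1 h2 h3 := by
    rw [if_pos (by omega), if_pos (by omega)]; exact P.ineq2 j i h1 h2 (by omega)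
  sbar := P.sbar
  sreg i j := if j < r - 1 then P.sreg i j else fun _ => 0
  sbar_fits i j h1 h2 h3 := by
    have h := P.sbar_fits i j h1 h2 (by omega)
    simp only [PatternC.lbar, PatternC.lbar', if_pos h3]
    exact h
  sreg_fits i j h1 h2 h3 := by
    have h := P.sreg_fits i j h1 h2 (by omega)
    have h4 : j + 1 ≤ r - 1 := by omega
    simp only [PatternC.lreg, PatternC.lreg', if_pos h3, if_pos h4]
    exact h
  sbar_supp i j h := P.sbar_supp i j (by omega)
  sreg_supp i j h := by
    by_cases hj : j < r - 1
    · rw [if_pos hj]; exact P.sreg_supp i j (by omega)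
    · rw [if_neg hj]

/-- The new row `η` of the inverse map. -/
def bwdEta (r : ℕ) (etab : ℕ → ℕ) (eta : ℕ → ℕ → ℤ) (j i : ℕ) : ℤ :=
  if j = r then (if 1 ≤ i ∧ i ≤ r then (etab i : ℤ) else 0) else eta j i

theorem bwdEta_of_ne {r : ℕ} {etab : ℕ → ℕ} {eta : ℕ → ℕ → ℤ} {j i : ℕ} (h : j ≠ r) :
    bwdEta r etab eta j i = eta j i := if_neg h

theorem bwdEta_top {r : ℕ} {etab : ℕ → ℕ} {eta : ℕ → ℕ → ℤ} {i : ℕ} (h1 : 1 ≤ i)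
    (h2 : i ≤ r) : bwdEta r etab eta r i = etab i := by
  simp [bwdEta, h1, h2]

/-- Inverse map. -/
def bwd (r : ℕ) (hr : 2 ≤ r) (etab : ℕ → ℕ)
    (hdec : ∀ i, 1 ≤ i → i ≤ r → etab (i + 1) ≤ etab i)
    (D : RectData' r (fun i => etab i - etab (i + 1))) (Q : POPC (r - 1))
    (hQ : Q.toPatternC.Bounds (fun i => etab i - D.l i)) : RPOP r where
  eta := bwdEta r etab Q.eta
  lam := Q.lam
  eta_supp j i h := by
    unfold bwdEta
    split_ifs with h1 h2
    · omega
    · rfl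
    · exact Q.eta_supp j i (by omega)
  lam_supp j i h := Q.lam_supp j i (by omega)
  ineq1 j i h1 h2 h3 := by
    rw [bwdEta_of_ne (by omega)]
    exact Q.ineq1 j i h1 h2 (by omega)
  ineq2 j i h1 h2 h3 := by
    by_cases hj : j + 1 = r
    · have hl := D.l_le i h1 (by omega)
      have hb := hQ i h1 (by omega)
      have hd := hdec i h1 (by omega)
      have e : r - 1 = j := by omega
      simp only [e] at hb hl
      rw [hj, bwdEta_top h1 (by omega), bwdEta_top (by omega) (by omega)]
      omega
    · rw [bwdEta_of_ne hj, bwdEta_of_ne hj]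
      exact Q.ineq2 j i h1 h2 (by omega)
  sbar := Q.sbar
  sreg i j := if j = r - 1 then D.s i else Q.sreg i j
  sbar_fits i j h1 h2 h3 := by
    have h := Q.sbar_fits i j h1 h2 (by omega)
    have hj : j ≠ r := by omega
    simp only [RPattern.lbar, RPattern.lbar', bwdEta_of_ne hj]
    exact h
  sreg_fits i j h1 h2 h3 := by
    by_cases hj : j + 1 = r
    · have hl := D.l_le i h1 (by omega)
      have hb := hQ i h1 (by omega)
      have hd := hdec i h1 (by omega)
      have hf := D.s_fits i h1 (by omega)
      have e : r - 1 = j := by omega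
      simp only [e] at hb hl hf
      have hir : i ≤ r := by omega
      have hir' : i + 1 ≤ r := by omega
      have hi' : 1 ≤ i + 1 := by omega
      simp only [RPattern.lreg, RPattern.lreg', e, if_true, hj, bwdEta_top h1 hir,
        bwdEta_top hi' hir']
      convert hf using 1 <;> omega
    · have h := Q.sreg_fits i j h1 h2 (by omega)
      have hj' : j ≠ r - 1 := by omega
      simp only [RPattern.lreg, RPattern.lreg', bwdEta_of_ne hj, if_neg hj']
      exact h
  sbar_supp i j h := Q.sbar_supp i j (by omega)
  sreg_supp i j h := by
    by_cases hj : j = r - 1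
    · rw [if_pos hj]; exact D.s_supp i (by omega)
    · rw [if_neg hj]; exact Q.sreg_supp i j (by omega)

theorem RPOP.ext_data {r : ℕ} {P Q : RPOP r} (h1 : P.eta = Q.eta) (h2 : P.lam = Q.lam)
    (h3 : P.sbar = Q.sbar) (h4 : P.sreg = Q.sreg) : P = Q := by
  rcases P with ⟨⟨_, _, _, _, _, _⟩, _, _, _, _, _, _⟩
  rcases Q with ⟨⟨_, _, _, _, _, _⟩, _, _, _, _, _, _⟩
  simp only at h1 h2 h3 h4
  subst h1 h2 h3 h4
  rfl

theorem POPC.ext_data {r : ℕ} {P Q : POPC r} (h1 : P.eta = Q.eta) (h2 : P.lam = Q.lam)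
    (h3 : P.sbar = Q.sbar) (h4 : P.sreg = Q.sreg) : P = Q := by
  rcases P with ⟨⟨_, _, _, _, _, _⟩, _, _, _, _, _, _⟩
  rcases Q with ⟨⟨_, _, _, _, _, _⟩, _, _, _, _, _, _⟩
  simp only at h1 h2 h3 h4
  subst h1 h2 h3 h4
  rfl

theorem RectData'.ext_data {r : ℕ} {n : ℕ → ℕ} {P Q : RectData' r n} (h1 : P.l = Q.l)
    (h2 : P.s = Q.s) : P = Q := by
  rcases P with ⟨_, _, _, _, _, _⟩
  rcases Q with ⟨_, _, _, _, _, _⟩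
  simp only at h1 h2
  subst h1 h2
  rfl

/-- The bijection. -/
def decompEquiv (r : ℕ) (hr : 2 ≤ r) (etab : ℕ → ℕ)
    (hdec : ∀ i, 1 ≤ i → i ≤ r → etab (i + 1) ≤ etab i) :
    {P : RPOP r // P.toRPattern.Bounds etab} ≃
        {D : RectData' r (fun i => etab i - etab (i + 1)) ×' POPC (r - 1) //
          D.2.toPatternC.Bounds (fun i => etab i - D.1.l i)} where
  toFun P := ⟨⟨fwdRect r hr etab P.1 P.2, fwdPOP r hr P.1⟩, by
    intro i h1 h2
    have h := P.1.ineq2 (r - 1) i h1 (by omega) (by omega)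
    have h0 := P.1.ineq1 (r - 1) i h1 (by omega) (by omega)
    have hb := P.2 i h1 (by omega)
    have hb' := P.2 (i + 1) (by omega) (by omega)
    have e : r - 1 + 1 = r := by omega
    have hi : 1 ≤ i ∧ i < r := by omega
    rw [e] at h
    simp only [fwdRect, fwdPOP, if_pos hi, RPattern.lreg, e]
    omega⟩
  invFun D := ⟨bwd r hr etab hdec D.1.1 D.1.2 D.2, by
    intro i h1 h2
    exact bwdEta_top h1 h2⟩
  left_inv P := by
    apply Subtype.ext
    apply RPOP.ext_data
    · funext j i
      simp only [bwd, bwdEta, fwdPOP]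
      split_ifs with h1 h2 h3
      · rw [h1]; exact (P.2 i h2.1 h2.2).symm
      · exact (P.1.eta_supp j i (by omega)).symm
      · rfl
      · exact (P.1.eta_supp j i (by omega)).symm
    · rfl
    · rfl
    · funext i j
      simp only [bwd, fwdRect, fwdPOP]
      split_ifs with h1 h2 h3
      · rw [h1]
      · exact (P.1.sreg_supp i j (by omega)).symm
      · rfl
      · exact (P.1.sreg_supp i j (by omega)).symm
  right_inv D := by
    obtain ⟨⟨D, Q⟩, hQ⟩ := D
    apply Subtype.ext
    have A : ∀ (x y : RectData' r (fun i => etab i - etab (i + 1))) (z w : POPC (r - 1)),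
        x = y → z = w → (⟨x, z⟩ : RectData' r (fun i => etab i - etab (i + 1)) ×' POPC (r - 1))
          = ⟨y, w⟩ := by
      rintro x _ z _ rfl rfl; rfl
    apply A
    · apply RectData'.ext_data
      · funext i
        by_cases hi : 1 ≤ i ∧ i < r
        · have hl := D.l_le i hi.1 hi.2
          have hb := hQ i hi.1 (by omega)
          have e : r - 1 + 1 = r := by omega
          simp only at hl hb
          simp only [fwdRect, bwd, if_pos hi, RPattern.lreg, e, bwdEta_top hi.1 hi.2.le]
          omega
        · simp only [fwdRect, if_neg hi]
          exact (D.l_supp i hi).symm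
      · funext i
        by_cases hi : 1 ≤ i ∧ i < r
        · simp only [fwdRect, bwd, if_pos hi, if_true]
        · simp only [fwdRect, if_neg hi]
          exact (D.s_supp i hi).symm
    · apply POPC.ext_data
      · funext j i
        simp only [fwdPOP, bwd]
        split_ifs with h
        · exact bwdEta_of_ne (by omega)
        · exact (Q.eta_supp j i (by omega)).symm
      · rfl
      · rfl
      · funext i j
        simp only [fwdPOP, bwd]
        split_ifs with h h'
        · omega
        · rfl
        · exact (Q.sreg_supp i j (by omega)).symm

/-- For `r ≥ 2` and `η̲ = (η_1 ≥ ⋯ ≥ η_r ≥ 0)`, `η_{r+1} = 0`,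
`n_i = η_i − η_{i+1}`, there is a bijection between the restricted POPs of rank `r` with
bounding sequence `η̲` and the pairs `((ℓ̲′, s̲′), Q)` where `ℓ′_i ≤ n_i`, `s′_i` fits into
`(ℓ′_i, n_i − ℓ′_i)` and `Q` is a POP of type `C` and rank `r−1` with bounding sequence
`(η_1 − ℓ′_1, …, η_{r-1} − ℓ′_{r-1})`.  It sends a restricted POP to the pair with
`ℓ′_i = ℓ_{i,r-1} = η^r_i − λ^{r-1}_i`, `s′_i = s_{i,r-1}`, and `Q` obtained by deleting
the top restricted row `η^r` and the partitions `s_{i,r-1}`. -/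
theorem rpop_decomposition (r : ℕ) (hr : 2 ≤ r) (etab : ℕ → ℕ)
    (hdec : ∀ i, 1 ≤ i → i ≤ r → etab (i + 1) ≤ etab i) (hzero : etab (r + 1) = 0) :
    ∃ e : {P : RPOP r // P.toRPattern.Bounds etab} ≃
        {D : RectData' r (fun i => etab i - etab (i + 1)) ×' POPC (r - 1) //
          D.2.toPatternC.Bounds (fun i => etab i - D.1.l i)},
      ∀ P : {P : RPOP r // P.toRPattern.Bounds etab},
        (∀ i, 1 ≤ i → i < r → (e P).1.1.l i = P.1.toRPattern.lreg i (r - 1)) ∧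
        (∀ i, 1 ≤ i → i < r → (e P).1.1.s i = P.1.sreg i (r - 1)) ∧
        (∀ j i, j ≤ r - 1 → (e P).1.2.eta j i = P.1.eta j i) ∧
        ((e P).1.2.lam = P.1.lam) ∧
        ((e P).1.2.sbar = P.1.sbar) ∧
        (∀ i j, j < r - 1 → (e P).1.2.sreg i j = P.1.sreg i j) := by
  refine ⟨decompEquiv r hr etab hdec, fun P => ⟨?_, ?_, ?_, rfl, rfl, ?_⟩⟩
  · intro i h1 h2
    exact if_pos ⟨h1, h2⟩
  · intro i h1 h2
    exact if_pos ⟨h1, h2⟩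
  · intro j i hj
    exact if_pos hj
  · intro i j hj
    exact if_pos hj

end SpWeyl
end

section
/- Let P be a generalized Gelfand–Tsetlin pattern of type C and rank r, with rows η¹, λ¹, …, η^r, λ^r and differences ℓ_{i,j̄}, ℓ_{i,j}. Then, in ℤ^r with standard basis ε_1,…,ε_r, the following identity holds: Σ_{k=1}^r λ^r_k ε_k − Σ_{1≤i≤j<r} ℓ_{i,j}(ε_i − ε_{j+1}) − Σ_{1≤i≤j≤r} ℓ_{i,j̄}(ε_i + ε_j) = Σ_{j=1}^r a_j ε_j, where a_j = 2·Σ_{i=1}^{j} η^j_i − Σ_{i=1}^{j} λ^j_i − Σ_{i=1}^{j−1} λ^{j−1}_i. (Here ε_i − ε_{j+1} is the positive root α_{i,j} and ε_i + ε_j is the positive root α_{i,j̄} of 𝔰𝔭_{2r}, so this says that the weight of the monomial attached to a POP with bounding sequence λ̲ equals the weight of the underlying pattern.) -/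
namespace SpWeyl

/-- The standard basis vector `ε_i` of `ℤ^r` (as a function of the coordinate `k`). -/
def eps (i : ℕ) : ℕ → ℤ := fun k => if k = i then 1 else 0

theorem weight_aux (E L : ℕ → ℕ → ℤ) (e : ℕ → ℤ) (n : ℕ) :
    (∑ i ∈ Finset.Icc 1 (n + 1), L (n + 1) i * e i)
      - (∑ j ∈ Finset.Icc 1 n, ∑ i ∈ Finset.Icc 1 j,
          (E (j + 1) i - L j i) * (e i - e (j + 1)))
      - (∑ j ∈ Finset.Icc 1 (n + 1), ∑ i ∈ Finset.Icc 1 j,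
          (L j i - E j i) * (e i + e j))
    = ∑ j ∈ Finset.Icc 1 (n + 1), (2 * (∑ i ∈ Finset.Icc 1 j, E j i)
        - (∑ i ∈ Finset.Icc 1 j, L j i)
        - (∑ i ∈ Finset.Icc 1 (j - 1), L (j - 1) i)) * e j := by
  induction n with
  | zero => simp; ring
  | succ n ih =>
    rw [Finset.sum_Icc_succ_top (b := n + 1) (by omega) (fun j => (2 * (∑ i ∈ Finset.Icc 1 j, E j i)
        - (∑ i ∈ Finset.Icc 1 j, L j i)
        - (∑ i ∈ Finset.Icc 1 (j - 1), L (j - 1) i)) * e j), ← ih,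
      Finset.sum_Icc_succ_top (b := n + 1) (by omega) (fun j => ∑ i ∈ Finset.Icc 1 j,
          (L j i - E j i) * (e i + e j)),
      Finset.sum_Icc_succ_top (b := n) (by omega) (fun j => ∑ i ∈ Finset.Icc 1 j,
          (E (j + 1) i - L j i) * (e i - e (j + 1)))]
    simp only [Finset.sum_Icc_succ_top (b := n + 1) (show 1 ≤ n + 1 + 1 by omega) (fun i => _ * _),
      Finset.sum_Icc_succ_top (b := n + 1) (show 1 ≤ n + 1 + 1 by omega) (E (n + 1 + 1)),
      Finset.sum_Icc_succ_top (b := n + 1) (show 1 ≤ n + 1 + 1 by omega) (L (n + 1 + 1)),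
      Nat.add_sub_cancel]
    simp only [mul_add, mul_sub, sub_mul, Finset.sum_add_distrib, Finset.sum_sub_distrib,
      ← Finset.sum_mul]
    ring

/-- For a generalized Gelfand–Tsetlin pattern of type `C` and rank `r`,
`Σ_k λ^r_k ε_k − Σ_{1≤i≤j<r} ℓ_{i,j}(ε_i − ε_{j+1}) − Σ_{1≤i≤j≤r} ℓ_{i,j̄}(ε_i + ε_j)
 = Σ_j a_j ε_j`, where `a_j = 2 Σ_{i≤j} η^j_i − Σ_{i≤j} λ^j_i − Σ_{i≤j-1} λ^{j-1}_i`.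
(Here `ε_i − ε_{j+1} = α_{i,j}` and `ε_i + ε_j = α_{i,j̄}` are the positive roots of
`𝔰𝔭_{2r}`, so the weight of the monomial attached to a POP equals the weight of the
underlying pattern.) -/
theorem pattern_weight_identity (r : ℕ) (hr : 1 ≤ r) (P : PatternC r) :
    (fun k => (∑ i ∈ Finset.Icc 1 r, P.lam r i * eps i k)
      - (∑ j ∈ Finset.Icc 1 (r - 1), ∑ i ∈ Finset.Icc 1 j,
          (P.eta (j + 1) i - P.lam j i) * (eps i k - eps (j + 1) k))
      - (∑ j ∈ Finset.Icc 1 r, ∑ i ∈ Finset.Icc 1 j,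
          (P.lam j i - P.eta j i) * (eps i k + eps j k)))
    = fun k => ∑ j ∈ Finset.Icc 1 r, P.aCoeff j * eps j k := by
  funext k
  obtain ⟨n, rfl⟩ : ∃ n, r = n + 1 := ⟨r - 1, by omega⟩
  exact weight_aux P.eta P.lam (fun i => eps i k) n

end SpWeyl
end
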